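/- arXiv:2003.14379 — 3 statements merged into one kernel-verified Lean document; each statement's English description precedes it below -/
import Mathlib

section
/- Fix a prime number p and an integer m ≥ 1. Let R = F_p[t_1, …, t_m, x_1, …, x_m] be the polynomial ring in 2m variables over the field F_p with p elements, let σ : R → R be the F_p-algebra automorphism determined by σ(t_i) = t_i and σ(x_i) = x_i + t_i for all i (an automorphism of order p), and let S ⊆ R be the subring of elements fixed by σ. Then: (i) R and S are Noetherian integrally closed integral domains and R is integral over S; (ii) [K(R) : K(S)] = p; (iii) for the prime ideal q = (t_1, …, t_m) of R and p' = q ∩ S, the residue field κ(q) equals F_p(x_1, …, x_m), the residue field κ(p') equals the subfield F_p(x_1^p, …, x_m^p), and hence [κ(q) : κ(p')] = p^m. In particular, for m ≥ 2 one has [κ(q) : κ(p')] > [K(R) : K(S)], so the degree bound [κ(q):κ(p)] ≤ [K(B):K(A)] can fail for an integral extension of Noetherian integrally closed domains without further hypotheses. -/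
noncomputable section

open Ideal

universe u v

/-- The field embedding `K(A) →+* K(B)` between fraction fields induced by an injective ring
homomorphism between integral domains. -/
def RingHom.fracMap {A : Type u} {B : Type v} [CommRing A] [IsDomain A] [CommRing B]
    [IsDomain B] (f : A →+* B) (hf : Function.Injective f) :
    FractionRing A →+* FractionRing B :=
  IsFractionRing.lift (g := (algebraMap B (FractionRing B)).comp f)
    ((IsFractionRing.injective B (FractionRing B)).comp hf)

/-- `[K(B) : K(A)]` as a cardinal, for an injective ring hom `f : A →+* B` of domains. -/
def fracRank {A : Type u} {B : Type v} [CommRing A] [IsDomain A] [CommRing B] [IsDomain B]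
    (f : A →+* B) (hf : Function.Injective f) : Cardinal.{v} :=
  letI := (f.fracMap hf).toAlgebra
  Module.rank (FractionRing A) (FractionRing B)

/-- `[K(B) : K(A)]` as a natural number (zero if infinite). -/
def fracFinrank {A : Type u} {B : Type v} [CommRing A] [IsDomain A] [CommRing B] [IsDomain B]
    (f : A →+* B) (hf : Function.Injective f) : ℕ :=
  letI := (f.fracMap hf).toAlgebra
  Module.finrank (FractionRing A) (FractionRing B)

/-- `K(B)/K(A)` is a finite extension. -/
def FracFinite {A : Type u} {B : Type v} [CommRing A] [IsDomain A] [CommRing B] [IsDomain B]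
    (f : A →+* B) (hf : Function.Injective f) : Prop :=
  letI := (f.fracMap hf).toAlgebra
  Module.Finite (FractionRing A) (FractionRing B)

/-- The canonical embedding of residue fields `κ(p) →+* κ(q)` for a prime `q` of `B` lying
over `p = q ∩ A`, where `κ(q)` is the fraction field of `B ⧸ q`. -/
def residueMap (A : Type u) {B : Type v} [CommRing A] [CommRing B] [Algebra A B]
    (q : Ideal B) (hq : q.IsPrime) :
    FractionRing (A ⧸ q.comap (algebraMap A B)) →+* FractionRing (B ⧸ q) :=
  haveI := hq
  (Ideal.quotientMap q (algebraMap A B) le_rfl).fracMap Ideal.quotientMap_injective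

/-- The field-extension structure `κ(q)/κ(p)`. -/
def residueAlgebra (A : Type u) {B : Type v} [CommRing A] [CommRing B] [Algebra A B]
    (q : Ideal B) (hq : q.IsPrime) :
    Algebra (FractionRing (A ⧸ q.comap (algebraMap A B))) (FractionRing (B ⧸ q)) :=
  (residueMap A q hq).toAlgebra

/-- The residue degree `[κ(q) : κ(p)]` as a cardinal. -/
def residueRank (A : Type u) {B : Type v} [CommRing A] [CommRing B] [Algebra A B]
    (q : Ideal B) (hq : q.IsPrime) : Cardinal.{v} :=
  haveI := hq
  letI := residueAlgebra A q hq
  Module.rank (FractionRing (A ⧸ q.comap (algebraMap A B))) (FractionRing (B ⧸ q))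

/-- The residue degree `[κ(q) : κ(p)]` as a natural number (zero if infinite). -/
def residueFinrank (A : Type u) {B : Type v} [CommRing A] [CommRing B] [Algebra A B]
    (q : Ideal B) (hq : q.IsPrime) : ℕ :=
  haveI := hq
  letI := residueAlgebra A q hq
  Module.finrank (FractionRing (A ⧸ q.comap (algebraMap A B))) (FractionRing (B ⧸ q))

/-- `κ(q)/κ(p)` is a finite extension. -/
def ResidueFinite (A : Type u) {B : Type v} [CommRing A] [CommRing B] [Algebra A B]
    (q : Ideal B) (hq : q.IsPrime) : Prop :=
  haveI := hq
  letI := residueAlgebra A q hq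
  Module.Finite (FractionRing (A ⧸ q.comap (algebraMap A B))) (FractionRing (B ⧸ q))

/-- A commutative ring is a regular local ring if it is a Noetherian local ring in which the
minimal number of generators of the maximal ideal equals the Krull dimension. -/
def IsRegularLocal (R : Type u) [CommRing R] : Prop :=
  IsNoetherianRing R ∧ ∃ h : IsLocalRing R,
    (↑(sInf {n : ℕ | ∃ s : Finset R, s.card = n ∧
        Ideal.span (s : Set R) = @IsLocalRing.maximalIdeal R _ h}) : WithBot ℕ∞) = ringKrullDim R

namespace CounterexampleCharP

variable (p m : ℕ)

/-- `R = 𝔽_p[t_1, …, t_m, x_1, …, x_m]`, where `t_i = X (Sum.inl i)` and `x_i = X (Sum.inr i)`. -/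
abbrev R : Type := MvPolynomial (Fin m ⊕ Fin m) (ZMod p)

/-- The `𝔽_p`-algebra endomorphism determined by `t_i ↦ t_i` and `x_i ↦ x_i + t_i`. -/
noncomputable def σ : R p m →ₐ[ZMod p] R p m :=
  MvPolynomial.aeval (Sum.elim (fun i => MvPolynomial.X (Sum.inl i))
    (fun i => MvPolynomial.X (Sum.inr i) + MvPolynomial.X (Sum.inl i)))

/-- `S`, the fixed subring of `σ`. -/
noncomputable def S : Subalgebra (ZMod p) (R p m) :=
  AlgHom.equalizer (σ p m) (AlgHom.id (ZMod p) (R p m))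

/-- The ideal `q = (t_1, …, t_m)` of `R`. -/
def q : Ideal (R p m) :=
  Ideal.span (Set.range fun i : Fin m => MvPolynomial.X (Sum.inl i))

/-- The canonical map `R → κ(q) = K(R ⧸ q)`. -/
noncomputable def π : R p m →+* FractionRing (R p m ⧸ q p m) :=
  (algebraMap (R p m ⧸ q p m) (FractionRing (R p m ⧸ q p m))).comp (Ideal.Quotient.mk (q p m))

end CounterexampleCharP

namespace CounterexampleCharP
open MvPolynomial
section partA
variable (p m : ℕ)

lemma sigma_t (i : Fin m) : σ p m (X (Sum.inl i)) = X (Sum.inl i) := by simp [σ]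
lemma sigma_x (i : Fin m) : σ p m (X (Sum.inr i)) = X (Sum.inr i) + X (Sum.inl i) := by simp [σ]

lemma sigma_pow_t (k : ℕ) (i : Fin m) : (σ p m ^ k) (X (Sum.inl i)) = X (Sum.inl i) := by
  induction k with
  | zero => simp
  | succ k ih => rw [pow_succ, AlgHom.mul_apply, sigma_t, ih]

lemma sigma_pow_x (k : ℕ) (i : Fin m) :
    (σ p m ^ k) (X (Sum.inr i)) = X (Sum.inr i) + (k : R p m) * X (Sum.inl i) := by
  induction k with
  | zero => simp
  | succ k ih =>
    rw [pow_succ, AlgHom.mul_apply, sigma_x, map_add, ih, sigma_pow_t]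
    push_cast; ring

variable [Fact p.Prime]

lemma sigma_pow_p : σ p m ^ p = 1 := by
  apply MvPolynomial.algHom_ext
  rintro (i | i)
  · rw [sigma_pow_t]; rfl
  · rw [sigma_pow_x, CharP.cast_eq_zero]; simp

lemma sigma_ne_one (hm : 1 ≤ m) : σ p m ≠ 1 := by
  intro h
  have := sigma_x p m ⟨0, hm⟩
  rw [h, AlgHom.one_apply, left_eq_add] at this
  exact X_ne_zero _ this

/-- `σ` as an automorphism. -/
def sigE : R p m ≃ₐ[ZMod p] R p m :=
  AlgEquiv.ofAlgHom (σ p m) (σ p m ^ (p - 1))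
    ((pow_succ' _ _).symm.trans (by
      rw [Nat.sub_add_cancel (Fact.out : p.Prime).one_le, sigma_pow_p]; rfl))
    ((pow_succ _ _).symm.trans (by
      rw [Nat.sub_add_cancel (Fact.out : p.Prime).one_le, sigma_pow_p]; rfl))

lemma sigE_apply (f : R p m) : sigE p m f = σ p m f := rfl

lemma sigE_pow_apply (k : ℕ) (f : R p m) : (sigE p m ^ k) f = (σ p m ^ k) f := by
  induction k generalizing f with
  | zero => rfl
  | succ k ih => rw [pow_succ, pow_succ, AlgEquiv.mul_apply, AlgHom.mul_apply, ih, sigE_apply]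

lemma orderOf_sigE (hm : 1 ≤ m) : orderOf (sigE p m) = p := by
  apply orderOf_eq_prime
  · ext1 f
    rw [sigE_pow_apply, sigma_pow_p]; rfl
  · intro h
    apply sigma_ne_one p m hm
    ext1 i
    rw [← sigE_apply, h]; rfl

lemma mem_S {f : R p m} : f ∈ S p m ↔ σ p m f = f := Iff.rfl

/-- The Galois group. -/
abbrev G : Type := Subgroup.zpowers (sigE p m)

lemma card_G (hm : 1 ≤ m) : Nat.card (G p m) = p := by
  rw [Nat.card_zpowers, orderOf_sigE p m hm]

lemma finite_G (hm : 1 ≤ m) : Finite (G p m) := by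
  apply Nat.finite_of_card_ne_zero
  rw [card_G p m hm]; exact (Fact.out : p.Prime).ne_zero

lemma G_smul_S (g : G p m) (s : R p m) (hs : s ∈ S p m) : g • s = s := by
  have hmem : (g : R p m ≃ₐ[ZMod p] R p m) ∈ MulAction.stabilizer (R p m ≃ₐ[ZMod p] R p m) s := by
    have : Subgroup.zpowers (sigE p m) ≤ MulAction.stabilizer (R p m ≃ₐ[ZMod p] R p m) s := by
      rw [Subgroup.zpowers_le]
      exact hs
    exact this g.2
  exact hmem

lemma isGaloisGroup : IsGaloisGroup (G p m) (S p m) (R p m) where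
  faithful := inferInstance
  commutes := ⟨fun g s f => by
    rw [Subalgebra.smul_def, Subalgebra.smul_def, smul_eq_mul, smul_eq_mul, smul_mul', G_smul_S p m g _ s.2]⟩
  isInvariant := ⟨fun f hf => ⟨⟨f, hf ⟨sigE p m, Subgroup.mem_zpowers _⟩⟩, rfl⟩⟩

lemma isIntegral_S (hm : 1 ≤ m) : Algebra.IsIntegral (S p m) (R p m) := by
  have := isGaloisGroup p m
  have := finite_G p m hm
  exact Algebra.IsInvariant.isIntegral (S p m) (R p m) (G p m)

lemma inj_S : Function.Injective (algebraMap (S p m) (R p m)) := Subtype.val_injective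

lemma noeth_S (hm : 1 ≤ m) : IsNoetherianRing (S p m) := by
  have := isIntegral_S p m hm
  have hft : Algebra.FiniteType (S p m) (R p m) :=
    Algebra.FiniteType.of_restrictScalars_finiteType (ZMod p) (S p m) (R p m)
  have hfin : Module.Finite (S p m) (R p m) := Algebra.IsIntegral.finite
  have h1 : (⊤ : Subalgebra (ZMod p) (R p m)).FG :=
    (inferInstance : Algebra.FiniteType (ZMod p) (R p m)).out
  have h := fg_of_fg_of_fg (A := ZMod p) (B := S p m) (C := R p m) h1 hfin.fg_top (inj_S p m)
  have : Algebra.FiniteType (ZMod p) (S p m) := ⟨h⟩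
  exact Algebra.FiniteType.isNoetherianRing (ZMod p) (S p m)

lemma frac_gen {A B H : Type} [CommRing A] [IsDomain A] [CommRing B] [IsDomain B] [Algebra A B]
    [Group H] [Finite H] [MulSemiringAction H B] [IsGaloisGroup H A B]
    (hinj : Function.Injective (algebraMap A B)) :
    fracFinrank (algebraMap A B) hinj = Nat.card H := by
  unfold fracFinrank
  let := ((algebraMap A B).fracMap hinj).toAlgebra
  have hinj' : Function.Injective ((algebraMap B (FractionRing B)).comp (algebraMap A B)) :=
    (IsFractionRing.injective B (FractionRing B)).comp hinj
  have : IsScalarTower A (FractionRing A) (FractionRing B) := by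
    apply IsScalarTower.of_algebraMap_eq
    intro s
    exact (IsFractionRing.lift_algebraMap hinj' s).symm
  let := IsFractionRing.mulSemiringAction H B (FractionRing B)
  have := IsGaloisGroup.toFractionRing H A B
  exact (IsGaloisGroup.card_eq_finrank H (FractionRing A) (FractionRing B)).symm

lemma intClosed_gen {A B : Type} [CommRing A] [IsDomain A] [CommRing B] [IsDomain B] [Algebra A B]
    [IsIntegrallyClosed B] (hinj : Function.Injective (algebraMap A B))
    (hdiv : ∀ (r : B) (a b : A), b ≠ 0 → r * algebraMap A B b = algebraMap A B a →
      ∃ c, algebraMap A B c = r) : IsIntegrallyClosed A := by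
  rw [isIntegrallyClosed_iff (FractionRing A)]
  intro x hx
  obtain ⟨a, b, hb, rfl⟩ := IsFractionRing.div_surjective (A := A) x
  have hb0 : b ≠ 0 := nonZeroDivisors.ne_zero hb
  have hb0' : algebraMap A B b ≠ 0 := fun h => hb0 (hinj (by rw [h, map_zero]))
  have hinj' : Function.Injective ((algebraMap B (FractionRing B)).comp (algebraMap A B)) :=
    (IsFractionRing.injective B (FractionRing B)).comp hinj
  let F : FractionRing A →+* FractionRing B := (algebraMap A B).fracMap hinj
  have hF : ∀ s : A, F (algebraMap _ _ s) = algebraMap B _ (algebraMap A B s) := fun s => by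
    exact IsFractionRing.lift_algebraMap hinj' s
  have hint : IsIntegral B (F (algebraMap _ _ a / algebraMap _ _ b)) := by
    obtain ⟨P, hP, hP0⟩ := hx
    refine ⟨P.map (algebraMap A B), hP.map _, ?_⟩
    rw [Polynomial.eval₂_map]
    have := congrArg F hP0
    rw [Polynomial.hom_eval₂, map_zero] at this
    rw [← this]
    congr 1
    ext s
    exact (hF s).symm
  obtain ⟨r, hr⟩ := IsIntegrallyClosed.isIntegral_iff.mp hint
  rw [map_div₀, hF, hF, eq_div_iff (by simpa using hb0'), ← map_mul] at hr
  have hr' : r * algebraMap A B b = algebraMap A B a :=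
    IsFractionRing.injective B (FractionRing B) hr
  obtain ⟨c, rfl⟩ := hdiv r a b hb0 hr'
  refine ⟨c, ?_⟩
  rw [eq_div_iff (by simpa using hb0), ← map_mul]
  congr 1
  apply hinj
  rw [map_mul, hr']

lemma intClosed_S : IsIntegrallyClosed (S p m) := by
  refine intClosed_gen (inj_S p m) fun r a b hb0 hr' => ?_
  have hb0' : (b : R p m) ≠ 0 := fun h => hb0 (Subtype.ext h)
  have hr' : r * (b : R p m) = a := hr'
  have hrS : r ∈ S p m := by
    have := congrArg (σ p m) hr'
    rw [map_mul, (mem_S p m).1 b.2, (mem_S p m).1 a.2, ← hr'] at this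
    exact (mem_S p m).2 (mul_right_cancel₀ hb0' this)
  exact ⟨⟨r, hrS⟩, rfl⟩

lemma frac_S (hm : 1 ≤ m) (hinj : Function.Injective (algebraMap (S p m) (R p m))) :
    fracFinrank (algebraMap (S p m) (R p m)) hinj = p := by
  have hG := isGaloisGroup p m
  have := finite_G p m hm
  rw [frac_gen (H := G p m), card_G p m hm]

end partA
end CounterexampleCharP
namespace CounterexampleCharP
open MvPolynomial
section partB
variable {p m : ℕ} [Fact p.Prime]

/-- The exponent vector attached to `e`. -/
def expo (e : Fin m → Fin p) : Fin m →₀ ℕ := Finsupp.equivFunOnFinite.symm fun j => (e j : ℕ)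

lemma expo_apply (e : Fin m → Fin p) (j : Fin m) : expo e j = (e j : ℕ) := rfl

lemma indep_poly (a : (Fin m → Fin p) → MvPolynomial (Fin m) (ZMod p))
    (h : ∑ e, a e ^ p * monomial (expo e) 1 = 0) (e : Fin m → Fin p) : a e = 0 := by
  have hp : p ≠ 0 := (Fact.out : p.Prime).ne_zero
  ext d
  have h1 := congrArg (coeff (p • d + expo e)) h
  rw [coeff_sum, Finset.sum_eq_single e] at h1
  · rw [coeff_mul_monomial', if_pos (by simp), add_tsub_cancel_right, mul_one, ← expand_zmod,
      coeff_expand_smul _ hp] at h1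
    simpa using h1
  · intro e' _ hne
    rw [coeff_mul_monomial']
    split_ifs with hle
    · obtain ⟨j, hj⟩ := Function.ne_iff.1 hne
      rw [← expand_zmod, coeff_expand_of_not_dvd (i := j), zero_mul]
      have hlej := hle j
      simp only [Finsupp.coe_tsub, Finsupp.coe_add, Finsupp.coe_smul, Pi.sub_apply, Pi.add_apply,
        Pi.smul_apply, smul_eq_mul, expo_apply] at hlej ⊢
      rintro ⟨k, hk⟩
      apply hj
      ext
      have h2 : p * d j + (e j : ℕ) = p * k + (e' j : ℕ) := by omega
      have h3 := congrArg (· % p) h2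
      simp only [Nat.mul_add_mod, Nat.mod_eq_of_lt (e j).2, Nat.mod_eq_of_lt (e' j).2] at h3
      exact h3.symm
    · rfl
  · simp

lemma monomial_split (n : Fin m →₀ ℕ) (c : ZMod p) :
    ∃ (u : MvPolynomial (Fin m) (ZMod p)) (e : Fin m → Fin p),
      monomial n c = u ^ p * monomial (expo e) 1 := by
  have hp : 0 < p := (Fact.out : p.Prime).pos
  refine ⟨monomial (Finsupp.equivFunOnFinite.symm fun j => n j / p) c,
    fun j => ⟨n j % p, Nat.mod_lt _ hp⟩, ?_⟩
  rw [monomial_pow, monomial_mul, mul_one, ZMod.pow_card]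
  refine congrArg (fun d => monomial d c) ?_
  ext j
  simp [expo_apply, Nat.div_add_mod]

variable {L : Type*} [Field L] (i : MvPolynomial (Fin m) (ZMod p) →+* L)

lemma closure_X (hs : ∀ z : L, ∃ a b, i b ≠ 0 ∧ z = i a / i b) :
    Subfield.closure (Set.range fun j => i (X j)) = ⊤ := by
  have key : ∀ a, i a ∈ Subfield.closure (Set.range fun j => i (X j)) := by
    intro a
    induction a using MvPolynomial.induction_on with
    | C c =>
      rw [← ZMod.natCast_zmod_val c, map_natCast, map_natCast]
      exact natCast_mem _ _
    | add f g hf hg => rw [map_add]; exact add_mem hf hg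
    | mul_X f j hf =>
      rw [map_mul]; exact mul_mem hf (Subfield.subset_closure ⟨j, rfl⟩)
  rw [eq_top_iff]
  rintro z -
  obtain ⟨a, b, -, rfl⟩ := hs z
  exact div_mem (key a) (key b)

lemma closure_Xp (hs : ∀ z : L, ∃ a b, i b ≠ 0 ∧ z = i a / i b) (y : L) :
    y ∈ Subfield.closure (Set.range fun j => i (X j) ^ p) ↔ ∃ z, z ^ p = y := by
  have : CharP L p := charP_of_injective_ringHom (f := i.comp C) (RingHom.injective _) p
  have : Subfield.closure (Set.range fun j => i (X j) ^ p) = (frobenius L p).fieldRange := by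
    rw [RingHom.fieldRange_eq_map, ← closure_X i hs, RingHom.map_field_closure, ← Set.range_comp]
    rfl
  rw [this, RingHom.mem_fieldRange]
  rfl

lemma finrank_gen {K : Type*} [Field K] [Algebra K L] (hi : Function.Injective i)
    (hs : ∀ z : L, ∃ a b, i b ≠ 0 ∧ z = i a / i b)
    (hK : (algebraMap K L).fieldRange = Subfield.closure (Set.range fun j => i (X j) ^ p)) :
    Module.finrank K L = p ^ m := by
  have hp : 0 < p := (Fact.out : p.Prime).pos
  have hK1 : ∀ k : K, ∃ z : L, z ^ p = algebraMap K L k := fun k => by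
    rw [← closure_Xp i hs, ← hK]; exact ⟨k, rfl⟩
  have hK2 : ∀ z : L, ∃ k : K, algebraMap K L k = z ^ p := fun z => by
    have : z ^ p ∈ (algebraMap K L).fieldRange := by
      rw [hK, closure_Xp i hs]; exact ⟨z, rfl⟩
    exact this
  let b : (Fin m → Fin p) → L := fun e => i (monomial (expo e) 1)
  have hli : LinearIndependent K b := by
    rw [Fintype.linearIndependent_iff]
    intro g hg e
    choose z hz using fun e => hK1 (g e)
    choose u v hv huv using fun e => hs (z e)
    -- common denominator
    let D := ∏ e, v e
    have hD : i D ≠ 0 := by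
      rw [map_prod]; exact Finset.prod_ne_zero_iff.2 fun e _ => hv e
    let w : (Fin m → Fin p) → MvPolynomial (Fin m) (ZMod p) :=
      fun e => u e * ∏ e' ∈ Finset.univ.erase e, v e'
    have hw : ∀ e, i (w e) = z e * i D := by
      intro e
      have : D = v e * ∏ e' ∈ Finset.univ.erase e, v e' :=
        (Finset.mul_prod_erase _ _ (Finset.mem_univ e)).symm
      rw [this, huv e, map_mul, map_mul, ← mul_assoc, div_mul_cancel₀ _ (hv e)]
    have hsum : ∑ e, w e ^ p * monomial (expo e) 1 = 0 := by
      apply hi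
      rw [map_zero, map_sum]
      have : ∀ e, i (w e ^ p * monomial (expo e) 1) = i D ^ p * (g e • b e) := by
        intro e
        rw [map_mul, map_pow, hw, mul_pow, hz, Algebra.smul_def]
        ring
      simp_rw [this]
      rw [← Finset.mul_sum, hg, mul_zero]
    have h0 := indep_poly w hsum e
    have h1 := hw e
    rw [h0, map_zero, eq_comm, mul_eq_zero, or_iff_left hD] at h1
    have h2 := hz e
    rw [h1, zero_pow hp.ne', eq_comm, map_eq_zero] at h2
    exact h2
  have hsp : ⊤ ≤ Submodule.span K (Set.range b) := by
    have key : ∀ a, i a ∈ Submodule.span K (Set.range b) := by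
      intro a
      induction a using MvPolynomial.induction_on' with
      | monomial n c =>
        obtain ⟨u, e, hu⟩ := monomial_split n c
        obtain ⟨k, hk⟩ := hK2 (i u)
        rw [hu, map_mul, map_pow, ← hk, ← Algebra.smul_def]
        exact Submodule.smul_mem _ _ (Submodule.subset_span ⟨e, rfl⟩)
      | add f g hf hg => rw [map_add]; exact add_mem hf hg
    rintro z -
    obtain ⟨a, d, hd, rfl⟩ := hs z
    obtain ⟨k, hk⟩ := hK2 (i d)⁻¹
    have : i a / i d = k • i (a * d ^ (p - 1)) := by
      rw [Algebra.smul_def, hk, map_mul, map_pow]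
      have : i d ^ p = i d ^ (p - 1) * i d := by rw [← pow_succ, Nat.sub_add_cancel hp]
      rw [inv_pow, this]
      field_simp
    rw [this]
    exact Submodule.smul_mem _ _ (key _)
  rw [Module.finrank_eq_card_basis (Module.Basis.mk hli hsp)]
  simp

/-- A polynomial all of whose partial derivatives vanish is a `p`-th power. -/
lemma exists_pow_of_pderiv (f : MvPolynomial (Fin m) (ZMod p)) (hf : ∀ j, pderiv j f = 0) :
    ∃ u, u ^ p = f := by
  have : CharP (MvPolynomial (Fin m) (ZMod p)) p := inferInstance
  have hdvd : ∀ n ∈ f.support, ∀ j, p ∣ n j := by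
    intro n hn j
    by_contra hnd
    have h0 : n j ≠ 0 := fun h => hnd (by simp [h])
    have h1 := congrArg (coeff (n - Finsupp.single j 1)) (hf j)
    have h2 : n - Finsupp.single j 1 + Finsupp.single j 1 = n := by
      apply tsub_add_cancel_of_le
      rw [Finsupp.single_le_iff]; omega
    rw [coeff_pderiv, h2, coeff_zero, mul_eq_zero, or_iff_right (mem_support_iff.1 hn)] at h1
    simp only [Finsupp.coe_tsub, Pi.sub_apply, Finsupp.single_eq_same] at h1
    rw [← Nat.cast_add_one, Nat.sub_add_cancel (by omega),
      ZMod.natCast_eq_zero_iff] at h1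
    exact hnd h1
  refine ⟨∑ n ∈ f.support, monomial (Finsupp.equivFunOnFinite.symm fun j => n j / p) (coeff n f), ?_⟩
  rw [sum_pow_char]
  conv_rhs => rw [f.as_sum]
  refine Finset.sum_congr rfl fun n hn => ?_
  rw [monomial_pow, ZMod.pow_card]
  refine congrArg (fun d => monomial d (coeff n f)) ?_
  ext j
  simp [Nat.mul_div_cancel' (hdvd n hn j)]

end partB

section partC
variable (p m : ℕ)

/-- Evaluation at `t = 0`. -/
def phi : R p m →ₐ[ZMod p] MvPolynomial (Fin m) (ZMod p) := aeval (Sum.elim 0 X)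

/-- The inclusion of the polynomial ring in the `x_i`. -/
def iot : MvPolynomial (Fin m) (ZMod p) →ₐ[ZMod p] R p m := aeval fun i => X (Sum.inr i)

lemma phi_iot (f) : phi p m (iot p m f) = f := by
  have : (phi p m).comp (iot p m) = AlgHom.id _ _ := by
    ext1 i; simp [phi, iot]
  exact DFunLike.congr_fun this f

lemma sub_iot_phi_mem (f : R p m) : f - iot p m (phi p m f) ∈ q p m := by
  have : (Ideal.Quotient.mkₐ (ZMod p) (q p m)).comp ((iot p m).comp (phi p m)) =
      Ideal.Quotient.mkₐ (ZMod p) (q p m) := by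
    ext1 i
    rcases i with i | i
    · simp only [phi, iot, AlgHom.comp_apply, aeval_X, Sum.elim_inl, Pi.zero_apply, map_zero]
      symm
      exact Ideal.Quotient.eq_zero_iff_mem.2 (Ideal.subset_span ⟨i, rfl⟩)
    · simp [phi, iot]
  rw [← Ideal.Quotient.eq]
  exact (DFunLike.congr_fun this f).symm

lemma q_eq_ker : q p m = RingHom.ker (phi p m) := by
  apply le_antisymm
  · rw [q, Ideal.span_le]
    rintro _ ⟨i, rfl⟩
    simp [phi]
  · intro f hf
    have := sub_iot_phi_mem p m f
    rw [RingHom.mem_ker] at hf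
    rwa [hf, map_zero, sub_zero] at this

lemma phi_deriv (f : R p m) (i : Fin m) :
    phi p m (pderiv (Sum.inl i) (σ p m f)) =
      phi p m (pderiv (Sum.inl i) f) + pderiv i (phi p m f) := by
  classical
  have hφσ : ∀ f, phi p m (σ p m f) = phi p m f := by
    intro f
    have : (phi p m).comp (σ p m) = phi p m := by
      ext1 i; rcases i with i | i <;> simp [phi, σ]
    exact DFunLike.congr_fun this f
  induction f using MvPolynomial.induction_on with
  | C c =>
    have h1 : σ p m (C c) = C c := (σ p m).commutes c
    have h2 : phi p m (C c) = C c := (phi p m).commutes c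
    rw [h1, h2]; simp
  | add f g hf hg => simp only [map_add, hf, hg]; ring
  | mul_X f k hf =>
    rw [map_mul, pderiv_mul, map_add, map_mul, map_mul, hf, hφσ, hφσ, pderiv_mul, map_add,
      map_mul, map_mul, map_mul, pderiv_mul]
    have : phi p m (pderiv (Sum.inl i) (σ p m (X k))) =
      phi p m (pderiv (Sum.inl i) (X k)) + pderiv i (phi p m (X k)) := by
      rcases k with k | k
      · simp [phi, σ]
      · by_cases h : i = k
        · subst h; simp [phi, σ, pderiv_X]
        · simp [phi, σ, pderiv_X, Pi.single_apply, Ne.symm h, h]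
    rw [this]; ring

variable [Fact p.Prime]

lemma q_prime : (q p m).IsPrime := by
  rw [q_eq_ker]; exact RingHom.ker_isPrime _

lemma phi_S (s : R p m) (hs : s ∈ S p m) : ∃ u, u ^ p = phi p m s := by
  apply exists_pow_of_pderiv
  intro j
  have := phi_deriv p m s j
  rw [(mem_S p m).1 hs, left_eq_add] at this
  exact this

/-- The norm of `x_j`. -/
def nrm (j : Fin m) : R p m := X (Sum.inr j) ^ p - X (Sum.inl j) ^ (p - 1) * X (Sum.inr j)

lemma nrm_mem (j : Fin m) : nrm p m j ∈ S p m := by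
  rw [mem_S]
  have hp : X (Sum.inl j) ^ p = (X (Sum.inl j) ^ (p - 1) * X (Sum.inl j) : R p m) := by
    rw [← pow_succ, Nat.sub_add_cancel (Fact.out : p.Prime).one_le]
  simp only [nrm, map_sub, map_mul, map_pow, sigma_t, sigma_x, add_pow_char, hp]
  ring

lemma phi_nrm (j : Fin m) : phi p m (nrm p m j) = X j ^ p := by
  have : p - 1 ≠ 0 := by have := (Fact.out : p.Prime).two_le; omega
  simp [nrm, phi, this]

end partC

section partD

lemma residueMap_apply (A : Type) {B : Type} [CommRing A] [CommRing B] [Algebra A B]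
    (q : Ideal B) (hq : q.IsPrime) (a : A) :
    residueMap A q hq (algebraMap (A ⧸ q.comap (algebraMap A B)) _ (Ideal.Quotient.mk _ a)) =
      algebraMap (B ⧸ q) _ (Ideal.Quotient.mk q (algebraMap A B a)) := by
  have := hq
  exact IsFractionRing.lift_algebraMap (A := A ⧸ q.comap (algebraMap A B))
    (g := (algebraMap (B ⧸ q) (FractionRing (B ⧸ q))).comp
      (Ideal.quotientMap q (algebraMap A B) le_rfl))
    ((IsFractionRing.injective (B ⧸ q) (FractionRing (B ⧸ q))).comp
      Ideal.quotientMap_injective) (Ideal.Quotient.mk _ a)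

lemma residueMap_range_le (A : Type) {B : Type} [CommRing A] [CommRing B] [Algebra A B]
    (q : Ideal B) (hq : q.IsPrime) [(q.comap (algebraMap A B)).IsPrime]
    (T : Subfield (FractionRing (B ⧸ q)))
    (hT : ∀ a : A, algebraMap (B ⧸ q) _ (Ideal.Quotient.mk q (algebraMap A B a)) ∈ T) :
    (residueMap A q hq).fieldRange ≤ T := by
  rintro _ ⟨z, rfl⟩
  obtain ⟨a, b, -, rfl⟩ := IsFractionRing.div_surjective (A := A ⧸ q.comap (algebraMap A B)) z
  obtain ⟨a, rfl⟩ := Ideal.Quotient.mk_surjective a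
  obtain ⟨b, rfl⟩ := Ideal.Quotient.mk_surjective b
  rw [map_div₀, residueMap_apply, residueMap_apply]
  exact div_mem (hT a) (hT b)

variable (p m : ℕ) [Fact p.Prime]

/-- The embedding of `𝔽_p[x]` in `κ(q)`. -/
def emb : MvPolynomial (Fin m) (ZMod p) →+* FractionRing (R p m ⧸ q p m) :=
  (π p m).comp (iot p m : MvPolynomial (Fin m) (ZMod p) →+* R p m)

lemma emb_X (j : Fin m) : emb p m (X j) = π p m (X (Sum.inr j)) := by
  simp [emb, iot]

lemma pi_eq (f : R p m) : π p m f = emb p m (phi p m f) := by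
  have h : Ideal.Quotient.mk (q p m) f = Ideal.Quotient.mk (q p m) (iot p m (phi p m f)) :=
    Ideal.Quotient.eq.2 (sub_iot_phi_mem p m f)
  exact congrArg (algebraMap (R p m ⧸ q p m) (FractionRing (R p m ⧸ q p m))) h

lemma emb_inj : Function.Injective (emb p m) := by
  rw [injective_iff_map_eq_zero]
  intro f hf
  have h1 : Ideal.Quotient.mk (q p m) (iot p m f) = 0 :=
    IsFractionRing.injective (R p m ⧸ q p m) (FractionRing (R p m ⧸ q p m))
      (by rw [map_zero]; exact hf)
  rw [Ideal.Quotient.eq_zero_iff_mem, q_eq_ker, RingHom.mem_ker, phi_iot] at h1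
  exact h1

lemma emb_surj [(q p m).IsPrime] (z : FractionRing (R p m ⧸ q p m)) :
    ∃ a b, emb p m b ≠ 0 ∧ z = emb p m a / emb p m b := by
  obtain ⟨a, b, hb, rfl⟩ := IsFractionRing.div_surjective (A := R p m ⧸ q p m) z
  obtain ⟨a, rfl⟩ := Ideal.Quotient.mk_surjective a
  obtain ⟨b, rfl⟩ := Ideal.Quotient.mk_surjective b
  refine ⟨phi p m a, phi p m b, ?_, ?_⟩
  · rw [← pi_eq]
    intro h
    apply nonZeroDivisors.ne_zero hb
    apply IsFractionRing.injective (R p m ⧸ q p m) (FractionRing (R p m ⧸ q p m))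
    rw [map_zero]; exact h
  · rw [← pi_eq, ← pi_eq]; rfl

lemma range_eq (hq : (q p m).IsPrime) [((q p m).comap (algebraMap (S p m) (R p m))).IsPrime] :
    (residueMap (S p m) (q p m) hq).fieldRange =
      Subfield.closure (Set.range fun j => emb p m (X j) ^ p) := by
  apply le_antisymm
  · apply residueMap_range_le
    intro s
    rw [closure_Xp (emb p m) (emb_surj p m)]
    obtain ⟨u, hu⟩ := phi_S p m s s.2
    refine ⟨emb p m u, ?_⟩
    rw [← map_pow, hu, ← pi_eq]; rfl
  · rw [Subfield.closure_le]
    rintro _ ⟨j, rfl⟩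
    have h := residueMap_apply (S p m) (q p m) hq ⟨nrm p m j, nrm_mem p m j⟩
    have h2 : emb p m (X j) ^ p = π p m (nrm p m j) := by
      rw [← map_pow, ← phi_nrm, ← pi_eq]
    exact ⟨_, h.trans h2.symm⟩

lemma residue_finrank (hq : (q p m).IsPrime)
    [((q p m).comap (algebraMap (S p m) (R p m))).IsPrime] :
    residueFinrank (S p m) (q p m) hq = p ^ m := by
  unfold residueFinrank
  let := residueAlgebra (S p m) (q p m) hq
  exact finrank_gen (emb p m) (emb_inj p m) (emb_surj p m) (range_eq p m hq)

end partD
end CounterexampleCharP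
set_option maxHeartbeats 1000000 in
set_option synthInstance.maxHeartbeats 400000 in
open CounterexampleCharP in
/-- For a prime `p` and `m ≥ 1`, with `R = 𝔽_p[t_i, x_i]`, `σ` the order-`p`
automorphism `t_i ↦ t_i, x_i ↦ x_i + t_i`, and `S` its fixed subring: (i) `R` and `S` are
Noetherian integrally closed domains and `R` is integral over `S`; (ii) `[K(R) : K(S)] = p`;
(iii) `q = (t_1, …, t_m)` is prime with `κ(q) = 𝔽_p(x_1, …, x_m)`,
`κ(q ∩ S) = 𝔽_p(x_1^p, …, x_m^p)` (as subfields of `κ(q)`), and `[κ(q) : κ(q ∩ S)] = p ^ m`;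
in particular for `m ≥ 2` the residue degree exceeds `[K(R) : K(S)]`. -/
theorem residue_degree_gt_fraction_degree_counterexample
    (p : ℕ) [Fact p.Prime] (m : ℕ) (hm : 1 ≤ m) :
    Function.Bijective (σ p m) ∧ σ p m ^ p = 1 ∧ σ p m ≠ 1 ∧
    IsDomain (R p m) ∧ IsDomain (S p m) ∧
    IsNoetherianRing (R p m) ∧ IsNoetherianRing (S p m) ∧
    IsIntegrallyClosed (R p m) ∧ IsIntegrallyClosed (S p m) ∧
    Algebra.IsIntegral (S p m) (R p m) ∧
    ∃ hinj : Function.Injective (algebraMap (S p m) (R p m)),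
      fracFinrank (algebraMap (S p m) (R p m)) hinj = p ∧
      ∃ hq : (q p m).IsPrime,
        haveI := hq
        haveI : ((q p m).comap (algebraMap (S p m) (R p m))).IsPrime :=
          hq.comap (algebraMap (S p m) (R p m))
        (Subfield.closure (Set.range fun i : Fin m => π p m (MvPolynomial.X (Sum.inr i))) = ⊤) ∧
        (letI := residueAlgebra (S p m) (q p m) hq;
          (algebraMap
              (FractionRing ((S p m) ⧸ (q p m).comap (algebraMap (S p m) (R p m))))
              (FractionRing (R p m ⧸ q p m))).fieldRange =
            Subfield.closure
              (Set.range fun i : Fin m => π p m (MvPolynomial.X (Sum.inr i)) ^ p)) ∧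
        residueFinrank (S p m) (q p m) hq = p ^ m ∧
        (2 ≤ m →
          fracFinrank (algebraMap (S p m) (R p m)) hinj <
            residueFinrank (S p m) (q p m) hq) := by
  have hpow := sigma_pow_p p m
  have hq := q_prime p m
  have hq' : ((q p m).comap (algebraMap (S p m) (R p m))).IsPrime :=
    hq.comap (algebraMap (S p m) (R p m))
  refine ⟨(sigE p m).bijective, hpow, sigma_ne_one p m hm, inferInstance, inferInstance,
    inferInstance, noeth_S p m hm, inferInstance, intClosed_S p m, isIntegral_S p m hm,
    inj_S p m, frac_S p m hm _, hq, ?_, ?_, residue_finrank p m hq, ?_⟩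
  · have h := closure_X (emb p m) (emb_surj p m)
    simp only [emb_X] at h
    exact h
  · have h := range_eq p m hq
    simp only [emb_X] at h
    exact h
  · intro h2
    rw [frac_S p m hm, residue_finrank p m hq]
    have := Nat.pow_lt_pow_right (Fact.out : p.Prime).one_lt (show 1 < m by omega)
    simpa using this

end
end

section
/- Fix a prime number p. Let R = F_p[t_i, x_i : i ∈ ℕ] be the polynomial ring in countably infinitely many variables t_i, x_i over the field F_p with p elements, let σ : R → R be the F_p-algebra automorphism determined by σ(t_i) = t_i and σ(x_i) = x_i + t_i for all i (an automorphism of order p), and let S ⊆ R be the subring of elements fixed by σ. Then R and S are integrally closed integral domains (neither Noetherian), R is integral over S, [K(R) : K(S)] = p, and yet for the prime ideal q = (t_i : i ∈ ℕ) of R with p' = q ∩ S, the residue field extension κ(p') ⊆ κ(q) has infinite degree. In particular, there exist an integral extension A ⊆ B of integrally closed domains and a prime q of B with p = q ∩ A such that [K(B) : K(A)] is finite but [κ(q) : κ(p)] is infinite. -/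
noncomputable section

open Ideal

universe u v

namespace CounterexampleInfinite

variable (p : ℕ)

/-- `R = 𝔽_p[t_i, x_i : i ∈ ℕ]`, where `t_i = X (Sum.inl i)` and `x_i = X (Sum.inr i)`. -/
abbrev R : Type := MvPolynomial (ℕ ⊕ ℕ) (ZMod p)

/-- The `𝔽_p`-algebra endomorphism determined by `t_i ↦ t_i` and `x_i ↦ x_i + t_i`. -/
noncomputable def σ : R p →ₐ[ZMod p] R p :=
  MvPolynomial.aeval (Sum.elim (fun i => MvPolynomial.X (Sum.inl i))
    (fun i => MvPolynomial.X (Sum.inr i) + MvPolynomial.X (Sum.inl i)))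

/-- `S`, the fixed subring of `σ`. -/
noncomputable def S : Subalgebra (ZMod p) (R p) :=
  AlgHom.equalizer (σ p) (AlgHom.id (ZMod p) (R p))

/-- The ideal `q = (t_i : i ∈ ℕ)` of `R`. -/
def q : Ideal (R p) :=
  Ideal.span (Set.range fun i : ℕ => MvPolynomial.X (Sum.inl i))

end CounterexampleInfinite


namespace CounterexampleInfinite

open MvPolynomial

lemma fracMap_tower {A B : Type} [CommRing A] [IsDomain A] [CommRing B] [IsDomain B]
    [Algebra A B] (hf : Function.Injective (algebraMap A B)) :
    letI := ((algebraMap A B).fracMap hf).toAlgebra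
    IsScalarTower A (FractionRing A) (FractionRing B) := by
  letI := ((algebraMap A B).fracMap hf).toAlgebra
  refine IsScalarTower.of_algebraMap_eq fun x => ?_
  rw [RingHom.algebraMap_toAlgebra, RingHom.fracMap, IsFractionRing.lift_algebraMap,
    IsScalarTower.algebraMap_apply A B (FractionRing B)]
  rfl

lemma not_fracFinite {A B : Type} [CommRing A] [IsDomain A] [CommRing B] [IsDomain B]
    [Algebra A B] (hf : Function.Injective (algebraMap A B)) (b : ℕ → B)
    (hb : LinearIndependent A b) : ¬ FracFinite (algebraMap A B) hf := by
  intro h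
  letI := ((algebraMap A B).fracMap hf).toAlgebra
  haveI := fracMap_tower hf
  have h' : Module.Finite (FractionRing A) (FractionRing B) := h
  have h1 : LinearIndependent A (fun i => algebraMap B (FractionRing B) (b i)) :=
    hb.map' (IsScalarTower.toAlgHom A B (FractionRing B)).toLinearMap
      (LinearMap.ker_eq_bot.2 (IsFractionRing.injective B (FractionRing B)))
  have h2 := (LinearIndependent.iff_fractionRing A (FractionRing A)).1 h1
  have := h2.finite
  exact not_finite ℕ

lemma not_residueFinite_of {A B : Type} [CommRing A] [CommRing B] [Algebra A B]
    (Q : Ideal B) (hQ : Q.IsPrime) (b : ℕ → B)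
    (hb : ∀ (s : Finset ℕ) (d : ℕ → A), ∑ i ∈ s, algebraMap A B (d i) * b i ∈ Q →
      ∀ j ∈ s, algebraMap A B (d j) ∈ Q) : ¬ ResidueFinite A Q hQ := by
  letI : Algebra (A ⧸ Q.comap (algebraMap A B)) (B ⧸ Q) :=
    (Ideal.quotientMap Q (algebraMap A B) le_rfl).toAlgebra
  refine not_fracFinite (A := A ⧸ Q.comap (algebraMap A B)) (B := B ⧸ Q)
    Ideal.quotientMap_injective (fun i => Ideal.Quotient.mk Q (b i)) ?_
  rw [linearIndependent_iff']
  intro s c hc j hj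
  choose d hd using fun i => Ideal.Quotient.mk_surjective (c i)
  have h1 : ∑ i ∈ s, algebraMap A B (d i) * b i ∈ Q := by
    rw [← Ideal.Quotient.eq_zero_iff_mem, map_sum, ← hc]
    refine Finset.sum_congr rfl fun i _ => ?_
    rw [← hd i, Algebra.smul_def, RingHom.algebraMap_toAlgebra, Ideal.quotientMap_mk, map_mul]
  rw [← hd j, Ideal.Quotient.eq_zero_iff_mem]
  exact hb s d h1 j hj

lemma fracFinite_of_galois {A B : Type} [CommRing A] [IsDomain A] [CommRing B] [IsDomain B]
    [Algebra A B] (hf : Function.Injective (algebraMap A B)) (H : Type) [Group H] [Finite H]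
    [MulSemiringAction H B] [IsGaloisGroup H A B] :
    FracFinite (algebraMap A B) hf ∧ fracFinrank (algebraMap A B) hf = Nat.card H := by
  letI := ((algebraMap A B).fracMap hf).toAlgebra
  haveI := fracMap_tower hf
  letI := IsFractionRing.mulSemiringAction H B (FractionRing B)
  haveI : IsGaloisGroup H (FractionRing A) (FractionRing B) :=
    IsGaloisGroup.to_isFractionRing H A B _ _
  exact ⟨IsGaloisGroup.finiteDimensional H (FractionRing A) (FractionRing B),
    (IsGaloisGroup.card_eq_finrank H (FractionRing A) (FractionRing B)).symm⟩

lemma closed_of {A B : Type} [CommRing A] [IsDomain A] [CommRing B] [IsDomain B]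
    [Algebra A B] (hf : Function.Injective (algebraMap A B)) (hB : IsIntegrallyClosed B)
    (h : ∀ (c : B) (a b : A), b ≠ 0 → c * algebraMap A B b = algebraMap A B a →
      ∃ d, algebraMap A B d = c) : IsIntegrallyClosed A := by
  letI := ((algebraMap A B).fracMap hf).toAlgebra
  haveI := fracMap_tower hf
  refine (isIntegrallyClosed_iff (FractionRing A)).2 fun {x} hx => ?_
  have h1 : IsIntegral A (algebraMap (FractionRing A) (FractionRing B) x) :=
    hx.algebraMap
  have h2 : IsIntegral B (algebraMap (FractionRing A) (FractionRing B) x) :=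
    h1.tower_top
  obtain ⟨c, hc⟩ := IsIntegrallyClosed.isIntegral_iff.1 h2
  obtain ⟨a, b, hb, rfl⟩ := IsFractionRing.div_surjective A x
  have hb0 : b ≠ 0 := nonZeroDivisors.ne_zero hb
  have hbK : algebraMap A (FractionRing A) b ≠ 0 := by
    simpa using hb0
  have hbR : algebraMap A B b ≠ 0 := (map_ne_zero_iff _ hf).2 hb0
  have hmap : ∀ s : A, algebraMap (FractionRing A) (FractionRing B)
      (algebraMap A (FractionRing A) s) = algebraMap B (FractionRing B) (algebraMap A B s) := by
    intro s
    rw [← IsScalarTower.algebraMap_apply, IsScalarTower.algebraMap_apply A B (FractionRing B)]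
  have hbL : algebraMap B (FractionRing B) (algebraMap A B b) ≠ 0 := by simpa using hbR
  rw [map_div₀, hmap, hmap, eq_div_iff hbL, ← map_mul] at hc
  have hc' : c * algebraMap A B b = algebraMap A B a := IsFractionRing.injective B (FractionRing B) hc
  obtain ⟨d, rfl⟩ := h c a b hb0 hc'
  refine ⟨d, ?_⟩
  rw [eq_div_iff hbK, ← map_mul]
  congr 1
  apply hf
  rw [map_mul, hc']

variable (p : ℕ)

@[simp] lemma σ_t (i : ℕ) : σ p (X (Sum.inl i)) = X (Sum.inl i) := by simp [σ]

@[simp] lemma σ_x (i : ℕ) : σ p (X (Sum.inr i)) = X (Sum.inr i) + X (Sum.inl i) := by simp [σ]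

lemma σ_pow_t (k i : ℕ) : (σ p ^ k) (X (Sum.inl i)) = X (Sum.inl i) := by
  induction k with
  | zero => simp
  | succ k ih => rw [pow_succ', AlgHom.mul_apply, ih, σ_t]

lemma σ_pow_x (k i : ℕ) :
    (σ p ^ k) (X (Sum.inr i)) = X (Sum.inr i) + (k : R p) * X (Sum.inl i) := by
  induction k with
  | zero => simp
  | succ k ih =>
    rw [pow_succ', AlgHom.mul_apply, ih, map_add, map_mul, map_natCast, σ_t, σ_x]
    push_cast; ring

lemma σ_pow_p : σ p ^ p = 1 := by
  refine MvPolynomial.algHom_ext fun i => ?_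
  rcases i with i | i
  · rw [σ_pow_t]; rfl
  · rw [σ_pow_x, CharP.cast_eq_zero (R p) p]; simp

lemma mem_S {f : R p} : f ∈ S p ↔ σ p f = f := by
  simp [S, AlgHom.mem_equalizer]

lemma t_mem (i : ℕ) : (X (Sum.inl i) : R p) ∈ S p := by simp [mem_S]

lemma t_mem_q (i : ℕ) : (X (Sum.inl i) : R p) ∈ q p := Ideal.subset_span ⟨i, rfl⟩

lemma not_noeth [Fact p.Prime] {A : Type} [CommRing A] (f : A →+* R p) (t : ℕ → A)
    (ht : ∀ i, f (t i) = X (Sum.inl i)) : ¬ IsNoetherianRing A := by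
  intro h
  obtain ⟨n, hn⟩ := monotone_stabilizes_iff_noetherian.2 h
    ⟨fun n => Ideal.span (t '' Set.Iio n), fun a b hab =>
      Ideal.span_mono (Set.image_mono (Set.Iio_subset_Iio hab))⟩
  have h1 : t n ∈ Ideal.span (t '' Set.Iio n) := by
    have := hn (n + 1) (Nat.le_succ n)
    change Ideal.span _ = Ideal.span _ at this
    rw [this]
    exact Ideal.subset_span ⟨n, Nat.lt_succ_self n, rfl⟩
  let e : R p →ₐ[ZMod p] ZMod p := aeval (Sum.elim (fun i => if i = n then 1 else 0) 0)
  let g : A →+* ZMod p := (e : R p →+* ZMod p).comp f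
  have h2 : Ideal.span (t '' Set.Iio n) ≤ RingHom.ker g := by
    rw [Ideal.span_le]
    rintro _ ⟨i, hi, rfl⟩
    have : i ≠ n := ne_of_lt hi
    simp [g, RingHom.mem_ker, ht, e, this]
  have h3 := h2 h1
  simp [g, RingHom.mem_ker, ht, e] at h3

/-- Kill the `t` variables. -/
def π : R p →ₐ[ZMod p] R p := aeval (Sum.elim 0 (fun i => X (Sum.inr i)))

lemma sub_π (f : R p) : f - π p f ∈ q p := by
  induction f using MvPolynomial.induction_on with
  | C a => simp [π]
  | add f g hf hg =>
    rw [map_add, add_sub_add_comm]; exact add_mem hf hg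
  | mul_X f i hf =>
    have : f * X i - π p (f * X i) = (f - π p f) * X i + π p f * (X i - π p (X i)) := by
      rw [map_mul]; ring
    rw [this]
    refine add_mem (Ideal.mul_mem_right _ _ hf) (Ideal.mul_mem_left _ _ ?_)
    rcases i with i | i
    · simpa [π] using t_mem_q p i
    · simp [π]

lemma q_prime [Fact p.Prime] : (q p).IsPrime := by
  have : q p = RingHom.ker (π p) := by
    apply le_antisymm
    · rw [q, Ideal.span_le]
      rintro _ ⟨i, rfl⟩
      simp [π, RingHom.mem_ker]
    · intro f hf
      have := sub_π p f
      rwa [(RingHom.mem_ker).1 hf, sub_zero] at this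
  rw [this]
  exact RingHom.ker_isPrime _

lemma σ_sub (f : R p) : σ p f - f ∈ q p := by
  induction f using MvPolynomial.induction_on with
  | C a => simp [σ]
  | add f g hf hg =>
    rw [map_add, add_sub_add_comm]; exact add_mem hf hg
  | mul_X f i hf =>
    have : σ p (f * X i) - f * X i = (σ p f - f) * σ p (X i) + f * (σ p (X i) - X i) := by
      rw [map_mul]; ring
    rw [this]
    refine add_mem (Ideal.mul_mem_right _ _ hf) (Ideal.mul_mem_left _ _ ?_)
    rcases i with i | i
    · simp
    · simpa using t_mem_q p i

lemma key (j : ℕ) (f : R p) :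
    pderiv (Sum.inl j) (σ p f) - pderiv (Sum.inl j) f - pderiv (Sum.inr j) f ∈ q p := by
  induction f using MvPolynomial.induction_on with
  | C a => simp [σ]
  | add f g hf hg =>
    have := add_mem hf hg
    simp only [map_add]
    convert this using 1
    ring
  | mul_X f i hf =>
    have h1 := σ_sub p f
    rcases i with i | i
    · have : pderiv (Sum.inl j) (σ p (f * X (Sum.inl i))) - pderiv (Sum.inl j) (f * X (Sum.inl i))
          - pderiv (Sum.inr j) (f * X (Sum.inl i)) =
          (pderiv (Sum.inl j) (σ p f) - pderiv (Sum.inl j) f - pderiv (Sum.inr j) f)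
            * X (Sum.inl i) + (σ p f - f) * pderiv (Sum.inl j) (X (Sum.inl i)) := by
        have h0 : pderiv (Sum.inr j) (X (Sum.inl i) : R p) = 0 :=
          pderiv_X_of_ne (by simp)
        simp only [map_mul, pderiv_mul, σ_t, h0]
        ring
      rw [this]
      exact add_mem (Ideal.mul_mem_right _ _ hf) (Ideal.mul_mem_right _ _ h1)
    · have : pderiv (Sum.inl j) (σ p (f * X (Sum.inr i))) - pderiv (Sum.inl j) (f * X (Sum.inr i))
          - pderiv (Sum.inr j) (f * X (Sum.inr i)) =
          (pderiv (Sum.inl j) (σ p f) - pderiv (Sum.inl j) f - pderiv (Sum.inr j) f)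
            * X (Sum.inr i) + pderiv (Sum.inl j) (σ p f) * X (Sum.inl i)
            + (σ p f - f) * pderiv (Sum.inl j) (X (Sum.inl i)) := by
        have h0 : pderiv (Sum.inl j) (X (Sum.inr i) : R p) = 0 :=
          pderiv_X_of_ne (by simp)
        have h2 : pderiv (Sum.inr j) (X (Sum.inr i) : R p)
            = pderiv (Sum.inl j) (X (Sum.inl i)) := by
          simp [pderiv_X, Pi.single_apply]
        simp only [map_mul, pderiv_mul, σ_x, h0, h2, map_add]
        ring
      rw [this]
      exact add_mem (add_mem (Ideal.mul_mem_right _ _ hf)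
        (Ideal.mul_mem_left _ _ (t_mem_q p i))) (Ideal.mul_mem_right _ _ h1)

lemma pderiv_S (j : ℕ) {f : R p} (hf : f ∈ S p) : pderiv (Sum.inr j) f ∈ q p := by
  have := key p j f
  rw [(mem_S p).1 hf, sub_self, zero_sub] at this
  exact (Submodule.neg_mem_iff _).1 this

lemma pderiv_q (j : ℕ) {f : R p} (hf : f ∈ q p) : pderiv (Sum.inr j) f ∈ q p := by
  refine Submodule.span_induction ?_ ?_ ?_ ?_ hf
  · rintro _ ⟨i, rfl⟩
    rw [pderiv_X_of_ne (by simp)]; exact zero_mem _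
  · simp
  · intro x y _ _ hx hy
    rw [map_add]; exact add_mem hx hy
  · intro a x hx h
    rw [smul_eq_mul, pderiv_mul]
    exact add_mem (Ideal.mul_mem_left _ _ hx) (Ideal.mul_mem_left _ _ h)

lemma not_residueFinite [Fact p.Prime] : ¬ ResidueFinite (S p) (q p) (q_prime p) := by
  refine not_residueFinite_of (q p) (q_prime p) (fun i => X (Sum.inr i)) fun s d h1 j hj => ?_
  replace h1 : ∑ i ∈ s, (d i : R p) * X (Sum.inr i) ∈ q p := h1
  have h2 := pderiv_q p j h1
  have h3 : ∑ i ∈ s, pderiv (Sum.inr j) (d i : R p) * X (Sum.inr i) ∈ q p :=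
    sum_mem fun i _ => Ideal.mul_mem_right _ _ (pderiv_S p j (d i).2)
  have h4 : pderiv (Sum.inr j) (∑ i ∈ s, (d i : R p) * X (Sum.inr i)) =
      ∑ i ∈ s, pderiv (Sum.inr j) (d i : R p) * X (Sum.inr i) + (d j : R p) := by
    simp only [map_sum, pderiv_mul, Finset.sum_add_distrib]
    congr 1
    rw [Finset.sum_eq_single j]
    · simp
    · intro i _ hij
      rw [pderiv_X_of_ne (by simpa using hij), mul_zero]
    · intro h; exact absurd hj h
  rw [h4] at h2
  exact (Submodule.add_mem_iff_right _ h3).1 h2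

variable [Fact p.Prime]

/-- `σ` as an automorphism. -/
def σE : R p ≃ₐ[ZMod p] R p :=
  AlgEquiv.ofAlgHom (σ p) (σ p ^ (p - 1))
    (by
      change σ p * σ p ^ (p - 1) = 1
      rw [← pow_succ', Nat.sub_add_cancel (Fact.out : p.Prime).one_le, σ_pow_p])
    (by
      change σ p ^ (p - 1) * σ p = 1
      rw [← pow_succ, Nat.sub_add_cancel (Fact.out : p.Prime).one_le, σ_pow_p])

lemma σE_apply (f : R p) : σE p f = σ p f := rfl

lemma σE_pow_apply (k : ℕ) (f : R p) : (σE p ^ k) f = (σ p ^ k) f := by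
  induction k with
  | zero => simp
  | succ k ih => rw [pow_succ', pow_succ', AlgEquiv.mul_apply, ih]; rfl

lemma σ_ne_one : σ p ≠ 1 := by
  intro h
  have := DFunLike.congr_fun h (X (Sum.inr 0))
  rw [σ_x] at this
  simp [X_ne_zero] at this

lemma orderOf_σE : orderOf (σE p) = p := by
  apply orderOf_eq_prime
  · ext1 f
    rw [σE_pow_apply, σ_pow_p]; rfl
  · intro h
    apply σ_ne_one p
    ext1 i
    rw [← σE_apply, h]; rfl

/-- The group generated by `σ`. -/
abbrev G : Subgroup (R p ≃ₐ[ZMod p] R p) := Subgroup.zpowers (σE p)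

lemma card_G : Nat.card (G p) = p := by
  rw [Nat.card_zpowers, orderOf_σE]

instance : Finite (G p) := Nat.finite_of_card_ne_zero (by
  rw [card_G]; exact (Fact.out : p.Prime).ne_zero)

lemma fixed {f : R p} (hf : f ∈ S p) (g : R p ≃ₐ[ZMod p] R p) (hg : g ∈ G p) : g f = f := by
  have h : G p ≤ MulAction.stabilizer (R p ≃ₐ[ZMod p] R p) f := by
    rw [Subgroup.zpowers_le, MulAction.mem_stabilizer_iff]
    exact (mem_S p).1 hf
  exact h hg

instance : IsGaloisGroup (G p) (S p) (R p) where
  faithful := inferInstance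
  commutes := ⟨fun g a b => by
    change (g : R p ≃ₐ[ZMod p] R p) ((a : R p) * b) = (a : R p) * (g : R p ≃ₐ[ZMod p] R p) b
    rw [map_mul, fixed p a.2 g g.2]⟩
  isInvariant := ⟨fun b hb => ⟨⟨b, (mem_S p).2 (hb ⟨σE p, Subgroup.mem_zpowers _⟩)⟩, rfl⟩⟩

lemma S_inj : Function.Injective (algebraMap (S p) (R p)) := Subtype.val_injective

lemma S_integral : Algebra.IsIntegral (S p) (R p) :=
  Algebra.IsInvariant.isIntegral (S p) (R p) (G p)

lemma S_fin : FracFinite (algebraMap (S p) (R p)) (S_inj p) ∧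
    fracFinrank (algebraMap (S p) (R p)) (S_inj p) = p := by
  have h := fracFinite_of_galois (S_inj p) (G p)
  rwa [card_G] at h

lemma S_closed : IsIntegrallyClosed (S p) := by
  refine closed_of (S_inj p) inferInstance fun c a b hb0 hc' => ?_
  have hbR : (b : R p) ≠ 0 := by simpa using hb0
  replace hc' : c * (b : R p) = a := hc'
  have hcS : c ∈ S p := by
    rw [mem_S]
    have := congrArg (σ p) hc'
    rw [map_mul, (mem_S p).1 a.2, (mem_S p).1 b.2, ← hc'] at this
    exact mul_right_cancel₀ hbR this
  exact ⟨⟨c, hcS⟩, rfl⟩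

end CounterexampleInfinite

set_option maxHeartbeats 1000000 in
set_option synthInstance.maxHeartbeats 400000 in
open CounterexampleInfinite in
/-- For a prime `p`, with `R = 𝔽_p[t_i, x_i : i ∈ ℕ]`, `σ` the order-`p`
automorphism `t_i ↦ t_i, x_i ↦ x_i + t_i`, and `S` its fixed subring: `R` and `S` are
integrally closed domains, neither is Noetherian, `R` is integral over `S`,
`[K(R) : K(S)] = p`, and yet for the prime `q = (t_i : i ∈ ℕ)` of `R` the residue field
extension `κ(q ∩ S) ⊆ κ(q)` has infinite degree.  In particular, there exist an integral
extension `A ⊆ B` of integrally closed domains and a prime `Q` of `B` such that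
`[K(B) : K(A)]` is finite but `[κ(Q) : κ(Q ∩ A)]` is infinite. -/
theorem residue_degree_infinite_counterexample (p : ℕ) [Fact p.Prime] :
    (Function.Bijective (σ p) ∧ σ p ^ p = 1 ∧ σ p ≠ 1 ∧
    IsDomain (R p) ∧ IsDomain (S p) ∧
    IsIntegrallyClosed (R p) ∧ IsIntegrallyClosed (S p) ∧
    ¬ IsNoetherianRing (R p) ∧ ¬ IsNoetherianRing (S p) ∧
    Algebra.IsIntegral (S p) (R p) ∧
    ∃ hinj : Function.Injective (algebraMap (S p) (R p)),
      FracFinite (algebraMap (S p) (R p)) hinj ∧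
      fracFinrank (algebraMap (S p) (R p)) hinj = p ∧
      ∃ hq : (q p).IsPrime, ¬ ResidueFinite (S p) (q p) hq) ∧
    ∃ (A : Type) (instA : CommRing A),
      haveI := instA
      ∃ (instDA : IsDomain A),
        haveI := instDA
        IsIntegrallyClosed A ∧
        ∃ (B : Type) (instB : CommRing B),
          haveI := instB
          ∃ (instDB : IsDomain B),
            haveI := instDB
            IsIntegrallyClosed B ∧
            ∃ (instAB : Algebra A B),
              haveI := instAB
              Algebra.IsIntegral A B ∧
              ∃ (hinj : Function.Injective (algebraMap A B)) (Q : Ideal B) (hQ : Q.IsPrime),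
                FracFinite (algebraMap A B) hinj ∧ ¬ ResidueFinite A Q hQ := by
  have hR : IsIntegrallyClosed (R p) := inferInstance
  refine ⟨⟨(σE p).bijective, σ_pow_p p, σ_ne_one p, inferInstance, inferInstance, hR,
    S_closed p, not_noeth p (RingHom.id _) _ (fun _ => rfl),
    not_noeth p (algebraMap (S p) (R p)) (fun i => ⟨_, t_mem p i⟩) (fun _ => rfl),
    S_integral p, S_inj p, (S_fin p).1, (S_fin p).2, q_prime p, not_residueFinite p⟩, ?_⟩
  exact ⟨S p, inferInstance, inferInstance, S_closed p, R p, inferInstance, inferInstance, hR,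
    inferInstance, S_integral p, S_inj p, q p, q_prime p, (S_fin p).1, not_residueFinite p⟩

end
end

section
/- Fix a prime number p and an integer m ≥ 1, and let ζ be a primitive p-th root of unity. Let T = ℤ[ζ][t_1, …, t_m, x_1, …, x_m] be the polynomial ring in 2m variables over ℤ[ζ], let σ : T → T be the ring automorphism fixing ℤ[ζ] pointwise and determined by σ(t_i) = t_i and σ(x_i) = ζ·x_i + t_i for all i (an automorphism of order p), and let U ⊆ T be the subring of elements fixed by σ. Then: (i) T and U are Noetherian integrally closed integral domains of characteristic zero and T is integral over U; (ii) [K(T) : K(U)] = p; (iii) for the prime ideal q = (1−ζ, t_1, …, t_m) of T and p' = q ∩ U, one has [κ(q) : κ(p')] = p^m. In particular, for m ≥ 2 there exist, in characteristic zero, an integral extension of Noetherian integrally closed domains A ⊆ B and a prime q of B over p = q ∩ A with [κ(q) : κ(p)] = p^m > p = [K(B) : K(A)]. -/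
noncomputable section

open Ideal

universe u v

namespace CounterexampleCharZero

variable (Zζ : Type u) [CommRing Zζ] (ζ : Zζ) (m : ℕ)

/-- `T = ℤ[ζ][t_1, …, t_m, x_1, …, x_m]`, where `t_i = X (Sum.inl i)`, `x_i = X (Sum.inr i)`. -/
abbrev T : Type u := MvPolynomial (Fin m ⊕ Fin m) Zζ

/-- The `ℤ[ζ]`-algebra endomorphism determined by `t_i ↦ t_i` and `x_i ↦ ζ·x_i + t_i`. -/
noncomputable def σ : T Zζ m →ₐ[Zζ] T Zζ m :=
  MvPolynomial.aeval (Sum.elim (fun i => MvPolynomial.X (Sum.inl i))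
    (fun i => MvPolynomial.C ζ * MvPolynomial.X (Sum.inr i) + MvPolynomial.X (Sum.inl i)))

/-- `U`, the fixed subring of `σ`. -/
noncomputable def U : Subalgebra Zζ (T Zζ m) :=
  AlgHom.equalizer (σ Zζ ζ m) (AlgHom.id Zζ (T Zζ m))

/-- The ideal `q = (1 - ζ, t_1, …, t_m)` of `T`. -/
def q : Ideal (T Zζ m) :=
  Ideal.span ({MvPolynomial.C (1 - ζ)} ∪ Set.range fun i : Fin m => MvPolynomial.X (Sum.inl i))

end CounterexampleCharZero

namespace CounterexampleCharZero
theorem aux_minpoly (p : ℕ) (hp : p.Prime) (R : Type u) [CommRing R] [IsDomain R] [CharZero R]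
    (K : Type u) [Field K] [Algebra R K] [IsFractionRing R K]
    (ζ : R) (hζ : IsPrimitiveRoot ζ p) : Polynomial.cyclotomic p ℤ = minpoly ℤ ζ := by
  have : CharZero K := charZero_of_injective_algebraMap (IsFractionRing.injective R K)
  rw [← minpoly.algebraMap_eq (IsFractionRing.injective R K) ζ]
  exact Polynomial.cyclotomic_eq_minpoly
    (hζ.map_of_injective (IsFractionRing.injective R K)) hp.pos

open Polynomial in
theorem aux_phi (p : ℕ) (hp : p.Prime) (R : Type u) [CommRing R] [IsDomain R] [CharZero R]
    (ζ : R) (hζ : IsPrimitiveRoot ζ p) (hgen : Algebra.adjoin ℤ {ζ} = ⊤) :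
    ∃ φ : R →+* ZMod p, φ ζ = 1 ∧ RingHom.ker φ = Ideal.span {1 - ζ} := by
  have := Fact.mk hp
  have hsurj : Function.Surjective (aeval ζ : ℤ[X] →ₐ[ℤ] R) := by
    rw [← AlgHom.range_eq_top, ← Algebra.adjoin_singleton_eq_range_aeval, hgen]
  have hmin : cyclotomic p ℤ = minpoly ℤ ζ := aux_minpoly p hp R (FractionRing R) ζ hζ
  have hint : IsIntegral ℤ ζ := hζ.isIntegral hp.pos
  let ev : ℤ[X] →+* ZMod p := (Int.castRingHom (ZMod p)).comp (evalRingHom 1)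
  have hc1 : (cyclotomic p ℤ).eval 1 = p := eval_one_cyclotomic_prime
  have hker : RingHom.ker ((aeval ζ : ℤ[X] →ₐ[ℤ] R) : ℤ[X] →+* R) ≤ RingHom.ker ev := by
    intro f hf
    have hf' : aeval ζ f = 0 := hf
    obtain ⟨g, rfl⟩ := hmin ▸ minpoly.isIntegrallyClosed_dvd hint hf'
    simp [RingHom.mem_ker, ev, hc1]
  let φ : R →+* ZMod p := RingHom.liftOfSurjective _ hsurj ⟨ev, hker⟩
  have hφ : ∀ f : ℤ[X], φ (aeval ζ f) = ((f.eval 1 : ℤ) : ZMod p) := fun f =>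
    RingHom.liftOfRightInverse_comp_apply _ _ _ ⟨ev, hker⟩ f
  have hφζ : φ ζ = 1 := by simpa using hφ X
  refine ⟨φ, hφζ, le_antisymm ?_ ?_⟩
  · have key : ∀ f : ℤ[X], aeval ζ f - ((f.eval 1 : ℤ) : R) ∈ Ideal.span {1 - ζ} := by
      intro f
      rw [Ideal.mem_span_singleton]
      have h : (X - C 1 : ℤ[X]) ∣ f - C (f.eval 1) := by
        rw [dvd_iff_isRoot]; simp
      obtain ⟨g, hg⟩ := h
      refine ⟨- aeval ζ g, ?_⟩
      have := congrArg (aeval ζ) hg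
      simp at this
      rw [this]; ring
    have hpm : (p : R) ∈ Ideal.span {1 - ζ} := by
      have := key (cyclotomic p ℤ)
      rw [hc1, hmin, minpoly.aeval] at this
      simpa using this
    intro x hx
    obtain ⟨f, rfl⟩ := hsurj x
    rw [RingHom.mem_ker, hφ, ZMod.intCast_zmod_eq_zero_iff_dvd] at hx
    obtain ⟨k, hk⟩ := hx
    have := key f
    rw [hk] at this
    have h2 := Ideal.add_mem _ this (Ideal.mul_mem_right (k : R) _ hpm)
    simpa using h2
  · rw [Ideal.span_singleton_le_iff_mem, RingHom.mem_ker]; simp [hφζ]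

theorem aux_noeth (R : Type u) [CommRing R] 
    (ζ : R) (hgen : Algebra.adjoin ℤ {ζ} = ⊤) : IsNoetherianRing R := by
  have : Algebra.FiniteType ℤ R := ⟨⟨{ζ}, by simpa using hgen⟩⟩
  exact Algebra.FiniteType.isNoetherianRing ℤ R

theorem aux_intclosed (p : ℕ) (hp : p.Prime) (R : Type u) [CommRing R] [IsDomain R] [CharZero R]
    (K : Type u) [Field K] [Algebra R K] [IsFractionRing R K]
    (ζ : R) (hζ : IsPrimitiveRoot ζ p) (hgen : Algebra.adjoin ℤ {ζ} = ⊤) :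
    IsIntegrallyClosed R := by
  have := Fact.mk hp
  have : CharZero K := charZero_of_injective_algebraMap (IsFractionRing.injective R K)
  let z : K := algebraMap R K ζ
  have hz : IsPrimitiveRoot z p := hζ.map_of_injective (IsFractionRing.injective R K)
  have hmap : (Algebra.adjoin ℤ {ζ}).map (IsScalarTower.toAlgHom ℤ R K) = Algebra.adjoin ℤ {z} := by
    rw [AlgHom.map_adjoin]; simp [z]
  have hR : ∀ r : R, algebraMap R K r ∈ Algebra.adjoin ℤ {z} := fun r => by
    rw [← hmap, hgen]; exact ⟨r, trivial, rfl⟩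
  have hR' : ∀ r : R, algebraMap R K r ∈ IntermediateField.adjoin ℚ {z} := fun r => by
    have h1 : Algebra.adjoin ℤ {z} ≤ ((IntermediateField.adjoin ℚ {z}).toSubalgebra.restrictScalars ℤ) :=
      Algebra.adjoin_le (by simp)
    exact h1 (hR r)
  have htop : IntermediateField.adjoin ℚ {z} = ⊤ := by
    rw [eq_top_iff]
    intro x _
    obtain ⟨a, b, hb, rfl⟩ := IsFractionRing.div_surjective (A := R) x
    exact div_mem (hR' a) (hR' b)
  have hintZ : IsIntegral ℚ z := (hz.isIntegral hp.pos).tower_top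
  have : IsCyclotomicExtension {p} ℚ K := by
    have : Algebra.IsIntegral ℚ K := by
      have h1 := IntermediateField.isAlgebraic_adjoin_simple hintZ
      rw [htop] at h1
      have := IntermediateField.topEquiv (F := ℚ) (E := K)
      have h2 := (this.isAlgebraic_iff).1 h1
      exact Algebra.isAlgebraic_iff_isIntegral.1 h2
    have h0 := hz.intermediateField_adjoin_isCyclotomicExtension ℚ
    rw [htop] at h0
    exact IsCyclotomicExtension.equiv {p} ℚ _ IntermediateField.topEquiv
  have := IsCyclotomicExtension.Rat.isIntegralClosure_adjoin_singleton_of_prime hz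
  have : Algebra.IsIntegral ℤ R := by
    rw [← integralClosure_eq_top_iff, eq_top_iff, ← hgen]
    refine Algebra.adjoin_le ?_
    rw [Set.singleton_subset_iff]
    exact hζ.isIntegral hp.pos
  rw [isIntegrallyClosed_iff K]
  intro x hx
  have hx' : IsIntegral ℤ x := isIntegral_trans x hx
  obtain ⟨y, hy⟩ := (IsIntegralClosure.isIntegral_iff (A := Algebra.adjoin ℤ ({z} : Set K))).1 hx'
  have : x ∈ (Algebra.adjoin ℤ {ζ}).map (IsScalarTower.toAlgHom ℤ R K) := by
    rw [hmap, ← hy]; exact y.2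
  obtain ⟨w, -, hw⟩ := this
  exact ⟨w, hw⟩

theorem aux_mv_intclosed (R : Type u) [CommRing R] [IsDomain R] [IsIntegrallyClosed R]
    (s : Type*) [Finite s] : IsIntegrallyClosed (MvPolynomial s R) := by
  obtain ⟨n, ⟨e⟩⟩ := Finite.exists_equiv_fin s
  suffices IsIntegrallyClosed (MvPolynomial (Fin n) R) from
    IsIntegrallyClosed.of_equiv (MvPolynomial.renameEquiv R e).symm.toRingEquiv
  clear e
  induction n with
  | zero => exact IsIntegrallyClosed.of_equiv (MvPolynomial.isEmptyAlgEquiv R (Fin 0)).symm.toRingEquiv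
  | succ n ih => exact IsIntegrallyClosed.of_equiv (MvPolynomial.finSuccEquiv R n).symm.toRingEquiv

open MvPolynomial in
theorem aux_pderiv (p : ℕ) [Fact p.Prime] (m : ℕ) (g : MvPolynomial (Fin m) (ZMod p))
    (hg : ∀ i, pderiv i g = 0) : ∃ h, expand p h = g := by
  have hsupp : ∀ d, coeff d g ≠ 0 → ∀ i, p ∣ d i := by
    intro d hd i
    by_cases h0 : d i = 0
    · simp [h0]
    have h := congrArg (coeff (d - Finsupp.single i 1)) (hg i)
    rw [coeff_pderiv, tsub_add_cancel_of_le (by simpa using Nat.one_le_iff_ne_zero.2 h0)] at h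
    simp only [coeff_zero, mul_eq_zero, hd, false_or] at h
    rw [← ZMod.natCast_eq_zero_iff, ← h]
    have : d i = (d - Finsupp.single i 1 : Fin m →₀ ℕ) i + 1 := by simp; omega
    rw [this]; push_cast; rfl
  have hmem : g ∈ (expand (σ := Fin m) (R := ZMod p) p).range := by
    rw [g.as_sum]
    refine sum_mem fun d hd => ?_
    have := hsupp d (mem_support_iff.1 hd)
    choose c hc using this
    refine ⟨monomial (Finsupp.equivFunOnFinite.symm c) (coeff d g), ?_⟩
    show expand p _ = _
    rw [expand_monomial]
    have : p • Finsupp.equivFunOnFinite.symm c = d := by ext i; simp [hc i]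
    rw [this]
  exact hmem

open MvPolynomial in
theorem aux_coeff (p : ℕ) [hp : Fact p.Prime] (m : ℕ) (a c : Fin m → Fin p) (b : Fin m →₀ ℕ)
    (g : MvPolynomial (Fin m) (ZMod p)) :
    coeff (p • b + Finsupp.equivFunOnFinite.symm fun i => (a i : ℕ))
      (expand p g * monomial (Finsupp.equivFunOnFinite.symm fun i => (c i : ℕ)) 1) =
      if a = c then coeff b g else 0 := by
  rw [coeff_mul_monomial']
  by_cases hac : a = c
  · subst hac
    simp [coeff_expand_smul p hp.out.ne_zero]
  · rw [if_neg hac]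
    split_ifs with hle
    · obtain ⟨i, hi⟩ : ∃ i, a i ≠ c i := by
        by_contra! h; exact hac (funext h)
      rw [mul_one]
      refine coeff_expand_of_not_dvd (p := p) (φ := g) (i := i) ?_
      intro hd
      have h1 : (c i : ℕ) ≤ p * b i + (a i : ℕ) := hle i
      have hd' : p ∣ p * b i + (a i : ℕ) - (c i : ℕ) := hd
      have h3 : ((p * b i + (a i : ℕ) - (c i : ℕ) : ℕ) + (c i:ℕ)) % p = (a i : ℕ) := by
        rw [Nat.sub_add_cancel h1, Nat.mul_add_mod, Nat.mod_eq_of_lt (a i).2]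
      obtain ⟨k, hk⟩ := hd'
      rw [hk, Nat.mul_add_mod, Nat.mod_eq_of_lt (c i).2] at h3
      exact hi (Fin.ext h3.symm)
    · rfl

open MvPolynomial in
theorem aux_expand_finrank (p : ℕ) [hp : Fact p.Prime] (m : ℕ) (A B : Type*) [CommRing A]
    [Nontrivial A] [CommRing B] [Algebra A B]
    (eA : A ≃+* MvPolynomial (Fin m) (ZMod p)) (eB : B ≃+* MvPolynomial (Fin m) (ZMod p))
    (hc : ∀ a, eB (algebraMap A B a) = expand p (eA a)) :
    Module.finrank A B = p ^ m := by
  let ex : (Fin m → Fin p) → (Fin m →₀ ℕ) := fun a => Finsupp.equivFunOnFinite.symm fun i => (a i : ℕ)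
  have hsmul : ∀ (a : A) (b : B), eB (a • b) = expand p (eA a) * eB b := fun a b => by
    rw [Algebra.smul_def, map_mul, hc]
  let v : (Fin m → Fin p) → B := fun a => eB.symm (monomial (ex a) 1)
  have hli : LinearIndependent A v := by
    rw [Fintype.linearIndependent_iff]
    intro g hg a
    apply eA.injective
    ext b
    have := congrArg (fun x => coeff (p • b + ex a) (eB x)) hg
    simp only [map_sum, hsmul, coeff_sum, map_zero, coeff_zero] at this ⊢
    rw [← this]
    calc coeff b (eA (g a)) = ∑ c, if a = c then coeff b (eA (g c)) else 0 := by simp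
      _ = _ := Finset.sum_congr rfl fun c _ => by
        simp only [v, RingEquiv.apply_symm_apply]
        exact (aux_coeff p m a c b (eA (g c))).symm
  have hsp : ⊤ ≤ Submodule.span A (Set.range v) := by
    intro f _
    obtain ⟨f, rfl⟩ := eB.symm.surjective f
    induction f using MvPolynomial.induction_on' with
    | add f g hf hg => rw [map_add]; exact Submodule.add_mem _ (hf trivial) (hg trivial)
    | monomial d r =>
      let a : Fin m → Fin p := fun i => ⟨d i % p, Nat.mod_lt _ hp.out.pos⟩
      let b : Fin m →₀ ℕ := Finsupp.equivFunOnFinite.symm fun i => d i / p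
      have : eB.symm (monomial d r) = eA.symm (monomial b r) • v a := by
        apply eB.injective
        rw [hsmul]
        simp only [v, RingEquiv.apply_symm_apply]
        rw [expand_monomial, monomial_mul, mul_one]
        have : p • b + ex a = d := by
          ext i
          simp [a, b, ex, Nat.div_add_mod]
        rw [this]
      rw [this]
      exact Submodule.smul_mem _ _ (Submodule.subset_span ⟨a, rfl⟩)
  rw [Module.finrank_eq_card_basis (Module.Basis.mk hli hsp)]
  simp

end CounterexampleCharZero

namespace CounterexampleCharZero

theorem aux_fracMap {A : Type u} {B : Type v} [CommRing A] [IsDomain A] [CommRing B]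
    [IsDomain B] (f : A →+* B) (hf : Function.Injective f) (a : A) :
    f.fracMap hf (algebraMap A (FractionRing A) a) = algebraMap B (FractionRing B) (f a) :=
  IsFractionRing.lift_algebraMap _ a

theorem aux_fracFinrank {A : Type u} {B : Type v} [CommRing A] [IsDomain A] [CommRing B]
    [IsDomain B] [Algebra A B] (f : A →+* B) (hf : Function.Injective f)
    (h : f = algebraMap A B) :
    fracFinrank f hf = Module.finrank A B := by
  let := (f.fracMap hf).toAlgebra
  have : IsScalarTower A (FractionRing A) (FractionRing B) := by
    refine IsScalarTower.of_algebraMap_eq fun a => ?_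
    rw [IsScalarTower.algebraMap_apply A B (FractionRing B), ← h]
    exact (aux_fracMap f hf a).symm
  exact IsFractionRing.finrank_eq A (FractionRing A) B (FractionRing B)

theorem aux_sub_intclosed {A : Type u} {B : Type v} [CommRing A] [IsDomain A] [CommRing B]
    [IsDomain B] [IsIntegrallyClosed B] (f : A →+* B) (hf : Function.Injective f)
    (h : ∀ (t : B) (a b : A), b ≠ 0 → f b * t = f a → ∃ c, f c = t) : IsIntegrallyClosed A := by
  rw [isIntegrallyClosed_iff (FractionRing A)]
  intro x hx
  have hx' : IsIntegral B (f.fracMap hf x) :=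
    hx.map_of_comp_eq f (f.fracMap hf) (RingHom.ext fun a => (aux_fracMap f hf a).symm)
  obtain ⟨t, ht⟩ := IsIntegrallyClosed.algebraMap_eq_of_integral hx'
  obtain ⟨a, b, hb, rfl⟩ := IsFractionRing.div_surjective (A := A) x
  have hb0 : b ≠ 0 := nonZeroDivisors.ne_zero hb
  have hfb : algebraMap B (FractionRing B) (f b) ≠ 0 := by
    simpa using (map_ne_zero_iff f hf).2 hb0
  rw [map_div₀, aux_fracMap, aux_fracMap, eq_div_iff hfb, ← map_mul] at ht
  obtain ⟨c, hc⟩ := h t a b hb0 (by rw [mul_comm]; exact IsFractionRing.injective B _ ht)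
  refine ⟨c, ?_⟩
  have hb1 : algebraMap A (FractionRing A) b ≠ 0 := by simpa using hb0
  rw [eq_div_iff hb1, ← map_mul]
  congr 1
  apply hf
  apply IsFractionRing.injective B (FractionRing B)
  rw [← ht, map_mul, hc]

section sigma
variable (Zζ : Type u) [CommRing Zζ] (ζ : Zζ) (m : ℕ)
open MvPolynomial

theorem σ_inl (i : Fin m) : σ Zζ ζ m (X (Sum.inl i)) = X (Sum.inl i) := by simp [σ]
theorem σ_inr (i : Fin m) : σ Zζ ζ m (X (Sum.inr i)) = C ζ * X (Sum.inr i) + X (Sum.inl i) := by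
  simp [σ]
theorem σ_C (a : Zζ) : σ Zζ ζ m (C a) = C a := by simp [σ]

theorem σ_pow_inl (n : ℕ) (i : Fin m) : (σ Zζ ζ m ^ n) (X (Sum.inl i)) = X (Sum.inl i) := by
  induction n with
  | zero => simp
  | succ n ih => rw [pow_succ', AlgHom.mul_apply, ih, σ_inl]

theorem σ_pow_inr (n : ℕ) (i : Fin m) : (σ Zζ ζ m ^ n) (X (Sum.inr i)) =
    C (ζ ^ n) * X (Sum.inr i) + C (∑ k ∈ Finset.range n, ζ ^ k) * X (Sum.inl i) := by
  induction n with
  | zero => simp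
  | succ n ih =>
    rw [pow_succ', AlgHom.mul_apply, ih, map_add, map_mul, map_mul, σ_C, σ_C, σ_inl, σ_inr,
      Finset.sum_range_succ, map_add, pow_succ, map_mul]
    ring

theorem σ_pow_p [IsDomain Zζ] (p : ℕ) (hp : p.Prime) (hζ : IsPrimitiveRoot ζ p) :
    σ Zζ ζ m ^ p = 1 := by
  apply MvPolynomial.algHom_ext
  rintro (i | i)
  · rw [σ_pow_inl]; rfl
  · rw [σ_pow_inr, hζ.pow_eq_one, hζ.geom_sum_eq_zero hp.one_lt]
    simp

theorem σ_ne_one (p : ℕ) (hp : p.Prime) (hζ : IsPrimitiveRoot ζ p) (hm : 1 ≤ m) :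
    σ Zζ ζ m ≠ 1 := by
  intro h
  have h1 := congrArg (coeff (Finsupp.single (Sum.inr ⟨0, hm⟩) 1))
    (DFunLike.congr_fun h (X (Sum.inr ⟨0, hm⟩)))
  rw [σ_inr] at h1
  simp [coeff_C_mul, coeff_X, Finsupp.single_left_inj] at h1
  exact hζ.ne_one hp.one_lt h1

/-- `σ` as an automorphism. -/
noncomputable def σe [IsDomain Zζ] (p : ℕ) (hp : p.Prime) (hζ : IsPrimitiveRoot ζ p) :
    T Zζ m ≃ₐ[Zζ] T Zζ m :=
  AlgEquiv.ofAlgHom (σ Zζ ζ m) (σ Zζ ζ m ^ (p - 1))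
    (by
      change σ Zζ ζ m * _ = 1
      rw [← pow_succ', Nat.sub_add_cancel hp.one_le, σ_pow_p Zζ ζ m p hp hζ])
    (by
      change _ * σ Zζ ζ m = 1
      rw [← pow_succ, Nat.sub_add_cancel hp.one_le, σ_pow_p Zζ ζ m p hp hζ])

theorem σe_apply [IsDomain Zζ] (p : ℕ) (hp : p.Prime) (hζ : IsPrimitiveRoot ζ p) (f : T Zζ m) :
    σe Zζ ζ m p hp hζ f = σ Zζ ζ m f := rfl

theorem σe_pow_apply [IsDomain Zζ] (p : ℕ) (hp : p.Prime) (hζ : IsPrimitiveRoot ζ p) (n : ℕ)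
    (f : T Zζ m) : (σe Zζ ζ m p hp hζ ^ n) f = (σ Zζ ζ m ^ n) f := by
  induction n with
  | zero => rfl
  | succ n ih => rw [pow_succ', pow_succ', AlgEquiv.mul_apply, AlgHom.mul_apply, ih, σe_apply]

theorem σe_order [IsDomain Zζ] (p : ℕ) (hp : p.Prime) (hζ : IsPrimitiveRoot ζ p) (hm : 1 ≤ m) :
    orderOf (σe Zζ ζ m p hp hζ) = p := by
  have := Fact.mk hp
  refine orderOf_eq_prime ?_ ?_
  · ext1 f
    rw [σe_pow_apply, σ_pow_p Zζ ζ m p hp hζ]; rfl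
  · intro h
    apply σ_ne_one Zζ ζ m p hp hζ hm
    ext1 f
    rw [← σe_apply Zζ ζ m p hp hζ, h]; rfl

theorem mem_U (f : T Zζ m) : f ∈ U Zζ ζ m ↔ σ Zζ ζ m f = f := Iff.rfl

theorem aux_galois [IsDomain Zζ] (p : ℕ) (hp : p.Prime) (hζ : IsPrimitiveRoot ζ p) :
    IsGaloisGroup (Subgroup.zpowers (σe Zζ ζ m p hp hζ)) (U Zζ ζ m) (T Zζ m) where
  faithful := ⟨fun {g h} H => Subtype.ext (AlgEquiv.ext fun x => H x)⟩
  commutes := by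
    refine ⟨fun g u t => ?_⟩
    have hg : ∀ g : Subgroup.zpowers (σe Zζ ζ m p hp hζ), g • (u : T Zζ m) = u := by
      rintro ⟨g, hg⟩
      have h1 : σe Zζ ζ m p hp hζ ∈ MulAction.stabilizer (T Zζ m ≃ₐ[Zζ] T Zζ m) (u : T Zζ m) := u.2
      exact (Subgroup.zpowers_le.2 h1) hg
    rw [Algebra.smul_def, Algebra.smul_def, smul_mul']
    congr 1
    exact hg g
  isInvariant := ⟨fun b hb => ⟨⟨b, hb ⟨_, Subgroup.mem_zpowers _⟩⟩, rfl⟩⟩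

/-- The reduction `T → 𝔽_p[x]`. -/
noncomputable def red (p : ℕ) (φ : Zζ →+* ZMod p) : T Zζ m →+* MvPolynomial (Fin m) (ZMod p) :=
  (MvPolynomial.map φ).comp
    (MvPolynomial.aeval (Sum.elim (fun _ => 0) X) : T Zζ m →ₐ[Zζ] MvPolynomial (Fin m) Zζ).toRingHom

variable (p : ℕ) (φ : Zζ →+* ZMod p)

theorem red_inl (i : Fin m) : red Zζ m p φ (X (Sum.inl i)) = 0 := by simp [red]
theorem red_inr (i : Fin m) : red Zζ m p φ (X (Sum.inr i)) = X i := by simp [red]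
theorem red_C (a : Zζ) : red Zζ m p φ (C a) = C (φ a) := by simp [red]

theorem red_surj : Function.Surjective (red Zζ m p φ) := by
  have h1 : Function.Surjective φ := ZMod.ringHom_surjective φ
  refine (MvPolynomial.map_surjective φ h1).comp ?_
  intro f
  refine ⟨rename Sum.inr f, ?_⟩
  change aeval (Sum.elim (fun _ => 0) X) (rename Sum.inr f) = f
  rw [aeval_rename, Sum.elim_comp_inr, aeval_X_left_apply]

theorem red_ker (hφ : RingHom.ker φ = Ideal.span {1 - ζ}) :
    RingHom.ker (red Zζ m p φ) = q Zζ ζ m := by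
  apply le_antisymm
  · intro f hf
    set ev : T Zζ m →ₐ[Zζ] MvPolynomial (Fin m) Zζ := MvPolynomial.aeval (Sum.elim (fun _ => 0) X)
    have h1 : (Ideal.Quotient.mkₐ Zζ (q Zζ ζ m)).comp
        ((rename Sum.inr : MvPolynomial (Fin m) Zζ →ₐ[Zζ] T Zζ m).comp ev) =
        Ideal.Quotient.mkₐ Zζ (q Zζ ζ m) := by
      apply MvPolynomial.algHom_ext
      rintro (i | i)
      · have : Ideal.Quotient.mk (q Zζ ζ m) (X (Sum.inl i)) = 0 :=
          Ideal.Quotient.eq_zero_iff_mem.2 (Ideal.subset_span (Or.inr ⟨i, rfl⟩))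
        simp [ev, this]
      · simp [ev]
    have h2 : ev f ∈ RingHom.ker (MvPolynomial.map φ : MvPolynomial (Fin m) Zζ →+* _) := hf
    rw [MvPolynomial.ker_map, hφ, Ideal.map_span, Set.image_singleton,
      Ideal.mem_span_singleton] at h2
    obtain ⟨g, hg⟩ := h2
    rw [← Ideal.Quotient.eq_zero_iff_mem]
    have h3 := DFunLike.congr_fun h1 f
    simp only [AlgHom.comp_apply, Ideal.Quotient.mkₐ_eq_mk] at h3
    rw [← h3, hg, Ideal.Quotient.eq_zero_iff_mem, map_mul, rename_C]
    exact Ideal.mul_mem_right _ _ (Ideal.subset_span (Or.inl rfl))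
  · refine Ideal.span_le.2 ?_
    rintro _ (h | ⟨i, rfl⟩)
    · rw [Set.mem_singleton_iff.1 h]
      have : 1 - ζ ∈ RingHom.ker φ := by rw [hφ]; exact Ideal.mem_span_singleton_self _
      change red Zζ m p φ _ = 0
      rw [red_C, RingHom.mem_ker.1 this, map_zero]
    · exact red_inl Zζ m p φ i

theorem red_σ (hφ : φ ζ = 1) (f : T Zζ m) : red Zζ m p φ (σ Zζ ζ m f) = red Zζ m p φ f := by
  have : (red Zζ m p φ).comp (σ Zζ ζ m).toRingHom = red Zζ m p φ := by
    apply MvPolynomial.ringHom_ext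
    · intro a
      change red Zζ m p φ (σ Zζ ζ m (C a)) = _
      rw [σ_C]
    · rintro (i | i)
      · change red Zζ m p φ (σ Zζ ζ m _) = _
        rw [σ_inl]
      · change red Zζ m p φ (σ Zζ ζ m _) = _
        rw [σ_inr, map_add, map_mul, red_C, red_inl, red_inr, hφ]; simp
  exact DFunLike.congr_fun this f

/-- An auxiliary map to dual numbers. -/
noncomputable def dual (i : Fin m) :
    T Zζ m →+* TrivSqZeroExt (MvPolynomial (Fin m) (ZMod p)) (MvPolynomial (Fin m) (ZMod p)) :=
  eval₂Hom ((TrivSqZeroExt.inlHom _ _).comp (C.comp φ))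
    (Sum.elim (fun j => TrivSqZeroExt.inr (if j = i then 1 else 0))
      (fun j => TrivSqZeroExt.inl (X j)))

theorem dual_fst (i : Fin m) (f : T Zζ m) : (dual Zζ m p φ i f).fst = red Zζ m p φ f := by
  have : ((TrivSqZeroExt.fstHom (ZMod p) (MvPolynomial (Fin m) (ZMod p))
      (MvPolynomial (Fin m) (ZMod p))).toRingHom).comp (dual Zζ m p φ i) = red Zζ m p φ := by
    apply MvPolynomial.ringHom_ext
    · intro a; simp [dual, red_C]
    · rintro (j | j)
      · by_cases h : j = i <;> simp [dual, red_inl, h]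
      · simp [dual, red_inr]
  exact DFunLike.congr_fun this f

theorem dual_σ (hφ : φ ζ = 1) (i : Fin m) (f : T Zζ m) :
    dual Zζ m p φ i (σ Zζ ζ m f) =
      dual Zζ m p φ i f + TrivSqZeroExt.inr (pderiv i (red Zζ m p φ f)) := by
  induction f using MvPolynomial.induction_on with
  | C a => rw [σ_C, red_C, pderiv_C]; simp
  | add f g hf hg => simp only [map_add, hf, hg, TrivSqZeroExt.inr_add]; ring
  | mul_X f n hf =>
    have hX : dual Zζ m p φ i (σ Zζ ζ m (X n)) =
        dual Zζ m p φ i (X n) + TrivSqZeroExt.inr (pderiv i (red Zζ m p φ (X n))) := by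
      rcases n with j | j
      · rw [σ_inl, red_inl]; simp
      · rw [σ_inr, red_inr, map_add, map_mul]
        simp [dual, hφ, pderiv_X, Pi.single_apply, eq_comm]
    rw [map_mul, map_mul, hf, hX, map_mul, map_mul]
    refine TrivSqZeroExt.ext ?_ ?_
    · simp
    · simp [dual_fst]
      ring

theorem red_U (hφ : φ ζ = 1) (hp : Fact p.Prime) (f : T Zζ m) (hf : σ Zζ ζ m f = f) :
    ∃ h, expand p h = red Zζ m p φ f := by
  refine aux_pderiv p m _ fun i => ?_
  have h := dual_σ Zζ ζ m p φ hφ i f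
  rw [hf] at h
  simpa using congrArg TrivSqZeroExt.snd h

theorem U_red [IsDomain Zζ] (hφ : φ ζ = 1) (hp : Fact p.Prime) (hζ : IsPrimitiveRoot ζ p)
    (h : MvPolynomial (Fin m) (ZMod p)) : ∃ f : U Zζ ζ m, red Zζ m p φ f = expand p h := by
  obtain ⟨f, rfl⟩ := red_surj Zζ m p φ h
  have hk : ∀ k, red Zζ m p φ ((σ Zζ ζ m ^ k) f) = red Zζ m p φ f := by
    intro k
    induction k with
    | zero => simp
    | succ k ih => rw [pow_succ', AlgHom.mul_apply, red_σ _ _ _ _ _ hφ, ih]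
  refine ⟨⟨∏ k ∈ Finset.range p, (σ Zζ ζ m ^ k) f, ?_⟩, ?_⟩
  · rw [mem_U, map_prod]
    simp_rw [← AlgHom.mul_apply, ← pow_succ']
    have h1 := Finset.prod_range_succ' (fun k => (σ Zζ ζ m ^ k) f) p
    rw [Finset.prod_range_succ, σ_pow_p Zζ ζ m p hp.out hζ, pow_zero] at h1
    by_cases h0 : f = 0
    · have hp0 := hp.out.ne_zero
      simp [h0, hp0]
    · exact (mul_right_cancel₀ h0 h1).symm
  · simp only [map_prod, hk, Finset.prod_const, Finset.card_range]
    rw [expand_zmod]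

end sigma

theorem aux_range (m p : ℕ) (hp : Fact p.Prime) {A : Type u} {B : Type v} [CommRing A] [IsDomain A]
    [CommRing B] [IsDomain B] (f : A →+* B) (hf : Function.Injective f)
    (eB : B ≃+* MvPolynomial (Fin m) (ZMod p))
    (h1 : ∀ a, ∃ h, MvPolynomial.expand p h = eB (f a))
    (h2 : ∀ h, ∃ a, eB (f a) = MvPolynomial.expand p h) :
    fracFinrank f hf = p ^ m := by
  let : Algebra A B := f.toAlgebra
  rw [aux_fracFinrank f hf rfl]
  let gB : A →+* MvPolynomial (Fin m) (ZMod p) := eB.toRingHom.comp f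
  let gE : MvPolynomial (Fin m) (ZMod p) →+* MvPolynomial (Fin m) (ZMod p) :=
    (MvPolynomial.expand (σ := Fin m) (R := ZMod p) p).toRingHom
  have hgB : Function.Injective gB := eB.injective.comp hf
  have hgE : Function.Injective gE := MvPolynomial.expand_injective hp.out.pos
  have hr : gB.range = gE.range := by
    ext x
    constructor
    · rintro ⟨a, rfl⟩; exact h1 a
    · rintro ⟨h, rfl⟩; exact h2 h
  let e1 : A ≃+* gB.range := RingEquiv.ofBijective gB.rangeRestrict
    ⟨fun a b hab => hgB (congrArg Subtype.val hab), gB.rangeRestrict_surjective⟩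
  let e2 : MvPolynomial (Fin m) (ZMod p) ≃+* gE.range := RingEquiv.ofBijective gE.rangeRestrict
    ⟨fun a b hab => hgE (congrArg Subtype.val hab), gE.rangeRestrict_surjective⟩
  let eA : A ≃+* MvPolynomial (Fin m) (ZMod p) := (e1.trans (RingEquiv.subringCongr hr)).trans e2.symm
  refine aux_expand_finrank p m A B eA eB fun a => ?_
  have h1 : e2 (eA a) = RingEquiv.subringCongr hr (e1 a) := e2.apply_symm_apply _
  exact (congrArg Subtype.val h1).symm

theorem aux_residue_gen (m p : ℕ) (hp : Fact p.Prime) {A : Type u} {B : Type v} [CommRing A]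
    [CommRing B] [Algebra A B] (Q : Ideal B) (hQ : Q.IsPrime)
    (r : B →+* MvPolynomial (Fin m) (ZMod p)) (hr : Function.Surjective r)
    (hk : RingHom.ker r = Q)
    (h1 : ∀ a : A, ∃ h, MvPolynomial.expand p h = r (algebraMap A B a))
    (h2 : ∀ h, ∃ a : A, r (algebraMap A B a) = MvPolynomial.expand p h) :
    residueFinrank A Q hQ = p ^ m := by
  subst hk
  refine aux_range m p hp (Ideal.quotientMap (RingHom.ker r) (algebraMap A B) le_rfl)
    Ideal.quotientMap_injective (RingHom.quotientKerEquivOfSurjective hr) ?_ ?_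
  · intro a
    obtain ⟨u, rfl⟩ := Ideal.Quotient.mk_surjective a
    rw [Ideal.quotientMap_mk]
    exact h1 u
  · intro h
    obtain ⟨u, hu⟩ := h2 h
    refine ⟨Ideal.Quotient.mk _ u, ?_⟩
    rw [Ideal.quotientMap_mk]
    exact hu

theorem aux_residue (Zζ : Type u) [CommRing Zζ] [IsDomain Zζ] (ζ : Zζ) (m p : ℕ) (hp : Fact p.Prime)
    (hζ : IsPrimitiveRoot ζ p) (φ : Zζ →+* ZMod p) (hφ : φ ζ = 1)
    (hφk : RingHom.ker φ = Ideal.span {1 - ζ}) (hq : (q Zζ ζ m).IsPrime) :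
    residueFinrank (U Zζ ζ m) (q Zζ ζ m) hq = p ^ m :=
  aux_residue_gen m p hp (q Zζ ζ m) hq (red Zζ m p φ) (red_surj Zζ m p φ)
    (red_ker Zζ ζ m p φ hφk) (fun u => red_U Zζ ζ m p φ hφ hp u u.2)
    (fun h => U_red Zζ ζ m p φ hφ hp hζ h)

end CounterexampleCharZero

set_option maxHeartbeats 1000000 in
set_option synthInstance.maxHeartbeats 400000 in
open CounterexampleCharZero in
/-- Fix a prime `p`, `m ≥ 1` and a primitive `p`-th root of unity `ζ`
(generating `ℤ[ζ]`, a characteristic-zero domain, over `ℤ`).  With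
`T = ℤ[ζ][t_i, x_i]`, `σ` the order-`p` automorphism `t_i ↦ t_i, x_i ↦ ζ·x_i + t_i`, and `U`
its fixed subring: (i) `T` and `U` are Noetherian integrally closed domains of characteristic
zero and `T` is integral over `U`; (ii) `[K(T) : K(U)] = p`; (iii) the ideal
`q = (1−ζ, t_1, …, t_m)` of `T` is prime and `[κ(q) : κ(q ∩ U)] = p ^ m`; in particular for
`m ≥ 2` the residue degree `p ^ m` exceeds `[K(T) : K(U)] = p` in characteristic zero. -/
theorem residue_degree_gt_fraction_degree_counterexample_charZero
    (p : ℕ) (hp : p.Prime) (m : ℕ) (hm : 1 ≤ m)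
    (Zζ : Type u) [CommRing Zζ] [IsDomain Zζ] [CharZero Zζ]
    (ζ : Zζ) (hζ : IsPrimitiveRoot ζ p) (hgen : Algebra.adjoin ℤ {ζ} = ⊤) :
    Function.Bijective (σ Zζ ζ m) ∧ σ Zζ ζ m ^ p = 1 ∧ σ Zζ ζ m ≠ 1 ∧
    IsDomain (T Zζ m) ∧ IsDomain (U Zζ ζ m) ∧
    CharZero (T Zζ m) ∧ CharZero (U Zζ ζ m) ∧
    IsNoetherianRing (T Zζ m) ∧ IsNoetherianRing (U Zζ ζ m) ∧
    IsIntegrallyClosed (T Zζ m) ∧ IsIntegrallyClosed (U Zζ ζ m) ∧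
    Algebra.IsIntegral (U Zζ ζ m) (T Zζ m) ∧
    ∃ hinj : Function.Injective (algebraMap (U Zζ ζ m) (T Zζ m)),
      fracFinrank (algebraMap (U Zζ ζ m) (T Zζ m)) hinj = p ∧
      ∃ hq : (q Zζ ζ m).IsPrime,
        residueFinrank (U Zζ ζ m) (q Zζ ζ m) hq = p ^ m ∧
        (2 ≤ m →
          fracFinrank (algebraMap (U Zζ ζ m) (T Zζ m)) hinj <
            residueFinrank (U Zζ ζ m) (q Zζ ζ m) hq) := by
  have hpf : Fact p.Prime := ⟨hp⟩
  have : IsNoetherianRing Zζ := aux_noeth Zζ ζ hgen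
  have : IsIntegrallyClosed Zζ := aux_intclosed p hp Zζ (FractionRing Zζ) ζ hζ hgen
  have hTic : IsIntegrallyClosed (T Zζ m) := aux_mv_intclosed Zζ _
  have hinj : Function.Injective (algebraMap (U Zζ ζ m) (T Zζ m)) := Subtype.val_injective
  have hord := σe_order Zζ ζ m p hp hζ hm
  have hfin : Finite (Subgroup.zpowers (σe Zζ ζ m p hp hζ)) := by
    apply Nat.finite_of_card_ne_zero
    rw [Nat.card_zpowers, hord]
    exact hp.ne_zero
  have hgal := aux_galois Zζ ζ m p hp hζ
  have hint : Algebra.IsIntegral (U Zζ ζ m) (T Zζ m) := hgal.isInvariant.isIntegral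
  have hUnoeth : IsNoetherianRing (U Zζ ζ m) := by
    have : Algebra.FiniteType (U Zζ ζ m) (T Zζ m) :=
      Algebra.FiniteType.of_restrictScalars_finiteType Zζ _ _
    have : Module.Finite (U Zζ ζ m) (T Zζ m) := Algebra.IsIntegral.finite
    have hft : Algebra.FiniteType Zζ (U Zζ ζ m) :=
      ⟨fg_of_fg_of_fg Zζ (U Zζ ζ m) (T Zζ m) Algebra.FiniteType.out Module.Finite.fg_top hinj⟩
    exact Algebra.FiniteType.isNoetherianRing Zζ _
  have hUic : IsIntegrallyClosed (U Zζ ζ m) := by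
    refine aux_sub_intclosed (algebraMap (U Zζ ζ m) (T Zζ m)) hinj fun t a b hb h => ?_
    refine ⟨⟨t, ?_⟩, rfl⟩
    have hb' : (b : T Zζ m) ≠ 0 := fun h => hb (Subtype.ext h)
    rw [mem_U]
    have h' : (b : T Zζ m) * t = a := h
    have h2 := congrArg (σ Zζ ζ m) h'
    rw [map_mul, (mem_U Zζ ζ m b).1 b.2, (mem_U Zζ ζ m a).1 a.2, ← h'] at h2
    exact mul_left_cancel₀ hb' h2
  obtain ⟨φ, hφ, hφk⟩ := aux_phi p hp Zζ ζ hζ hgen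
  have hq : (q Zζ ζ m).IsPrime := by
    rw [← red_ker Zζ ζ m p φ hφk]
    exact RingHom.ker_isPrime _
  have h1 : fracFinrank (algebraMap (U Zζ ζ m) (T Zζ m)) hinj = p := by
    rw [aux_fracFinrank _ hinj rfl,
      ← IsGaloisGroup.card_eq_finrank' (Subgroup.zpowers (σe Zζ ζ m p hp hζ)), Nat.card_zpowers,
      hord]
  have h2 := aux_residue Zζ ζ m p hpf hζ φ hφ hφk hq
  refine ⟨(σe Zζ ζ m p hp hζ).bijective, σ_pow_p Zζ ζ m p hp hζ, σ_ne_one Zζ ζ m p hp hζ hm,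
    inferInstance, inferInstance, inferInstance, ?_, inferInstance, hUnoeth, hTic, hUic, hint,
    hinj, h1, hq, h2, fun hm2 => ?_⟩
  · exact ⟨fun a b hab => Nat.cast_injective (R := T Zζ m)
      (by simpa using congrArg (algebraMap (U Zζ ζ m) (T Zζ m)) hab)⟩
  · rw [h1, h2]
    exact lt_self_pow₀ hp.one_lt hm2

end
end
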